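/- arXiv:2406.03674 — 4 statements merged into one kernel-verified Lean document; each statement's English description precedes it below -/
import Mathlib

section
/- Richness ratio between safe classes: let m, m' ∈ ℕ with m ≤ m'. (Upper bound) For every bid history H₋ = (β₋^1,…,β₋^T) and every valuation vector v, max_{b' ∈ 𝒫*_{≤m'}} ∑_{t=1}^{T} V(b';β₋^t) ≤ (m'/m) · max_{b ∈ 𝒫*_{≤m}} ∑_{t=1}^{T} V(b;β₋^t). (Tightness) For every δ ∈ (0, 1/2] there exist T, K, M, a valuation vector v and a bid history H₋ such that max_{b ∈ 𝒫*_{≤m}} ∑_{t=1}^{T} V(b;β₋^t) > 0 and max_{b' ∈ 𝒫*_{≤m'}} ∑_{t=1}^{T} V(b';β₋^t) ≥ (m'/m − δ) · max_{b ∈ 𝒫*_{≤m}} ∑_{t=1}^{T} V(b;β₋^t). -/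
open Finset

namespace Auction

/-- A competing-bid profile for an auction of `K` identical units, represented by the
function sending `j ∈ {1,…,K}` to the `j`-th smallest element of the multiset of the
`K` largest competing bids. -/
structure Profile (K : ℕ) where
  c : ℕ → ℝ
  mono : ∀ i j : ℕ, 1 ≤ i → i ≤ j → j ≤ K → c i ≤ c j
  nonneg : ∀ j : ℕ, 1 ≤ j → j ≤ K → 0 ≤ c j

/-- A bid vector: `n` units are demanded and `bid j` is the bid for the `j`-th unit
(for `1 ≤ j ≤ n`). -/
structure BidVec where
  n : ℕ
  bid : ℕ → ℝ

/-- A bid vector is valid if its bids are non-increasing and positive. -/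
def BidVec.Valid (b : BidVec) : Prop :=
  (∀ i j : ℕ, 1 ≤ i → i ≤ j → j ≤ b.n → b.bid j ≤ b.bid i) ∧
  ∀ j : ℕ, 1 ≤ j → j ≤ b.n → 0 < b.bid j

open Classical in
/-- The number of units the bidder wins (ties broken in the bidder's favor): the
largest `r ≤ min n K` such that the bidder's `j`-th bid is at least the `j`-th
threshold `β.c j` for every `j ≤ r`. -/
noncomputable def alloc (K : ℕ) (b : BidVec) (β : Profile K) : ℕ :=
  ((Finset.Icc 1 (min b.n K)).filter fun r => ∀ j ∈ Finset.Icc 1 r, β.c j ≤ b.bid j).sup id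

/-- The clearing price: the `K`-th highest among all submitted bids (taken to be `0`
when the bidder wins no unit). -/
noncomputable def price (K : ℕ) (b : BidVec) (β : Profile K) : ℝ :=
  if alloc K b β = 0 then 0
  else if alloc K b β < K then min (b.bid (alloc K b β)) (β.c (alloc K b β + 1))
  else b.bid K

/-- The value obtained by the bidder. -/
noncomputable def value (v : ℕ → ℝ) (K : ℕ) (b : BidVec) (β : Profile K) : ℝ :=
  ∑ j ∈ Finset.Icc 1 (alloc K b β), v j

/-- The bidder's total payment. -/
noncomputable def payment (K : ℕ) (b : BidVec) (β : Profile K) : ℝ :=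
  price K b β * (alloc K b β : ℝ)

/-- The RoI constraint (with target RoI `γ = 0`) against a single competing-bid profile. -/
def Feasible (v : ℕ → ℝ) (K : ℕ) (b : BidVec) (β : Profile K) : Prop :=
  payment K b β ≤ value v K b β

/-- A bid vector is safe if it satisfies the RoI constraint against every profile. -/
def Safe (v : ℕ → ℝ) (K : ℕ) (b : BidVec) : Prop :=
  ∀ β : Profile K, Feasible v K b β

/-- A valuation vector: nonnegative and non-increasing on `{1,…,M}`. -/
def ValidValuation (M : ℕ) (v : ℕ → ℝ) : Prop :=
  (∀ j : ℕ, 1 ≤ j → j ≤ M → 0 ≤ v j) ∧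
  ∀ i j : ℕ, 1 ≤ i → i ≤ j → j ≤ M → v j ≤ v i

/-- The average cumulative valuation `w_j = (v_1 + ⋯ + v_j) / j`. -/
noncomputable def w (v : ℕ → ℝ) (j : ℕ) : ℝ :=
  (∑ ℓ ∈ Finset.Icc 1 j, v ℓ) / (j : ℝ)

/-- An `m`-uniform bidding strategy: bid-quantity pairs `(b j, q j)` for `1 ≤ j ≤ m`. -/
structure Uniform where
  m : ℕ
  b : ℕ → ℝ
  q : ℕ → ℕ

/-- Cumulative quantities `Q j = q 1 + ⋯ + q j`. -/
def Uniform.Q (s : Uniform) (j : ℕ) : ℕ := ∑ ℓ ∈ Finset.Icc 1 j, s.q ℓ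

/-- `s` is a genuine `m`-uniform strategy for maximum demand `M`:
`b 1 > b 2 > ⋯ > b m > 0`, positive quantities, and `Q m ≤ M`. -/
def Uniform.IsUniform (M : ℕ) (s : Uniform) : Prop :=
  1 ≤ s.m ∧
  (∀ j : ℕ, 1 ≤ j → j ≤ s.m → 0 < s.q j) ∧
  0 < s.b s.m ∧
  (∀ j : ℕ, 1 ≤ j → j < s.m → s.b (j + 1) < s.b j) ∧
  s.Q s.m ≤ M

/-- The bid vector associated to a uniform strategy: the bid on the `j`-th unit is
`b ℓ`, where `ℓ` is least with `j ≤ Q ℓ`. -/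
noncomputable def Uniform.toBidVec (s : Uniform) : BidVec :=
  ⟨s.Q s.m, fun j => s.b (sInf {ℓ : ℕ | j ≤ s.Q ℓ})⟩

/-- The 1-uniform strategy bidding `b` on `q` units. -/
def single (b : ℝ) (q : ℕ) : Uniform := ⟨1, fun _ => b, fun _ => q⟩

/-- Membership in the class `𝒫*_{≤ m}` of safe undominated strategies with at most `m`
bid-quantity pairs: strategies determined by a tuple `0 < Q 1 < ⋯ < Q k ≤ M` (`k ≤ m`)
via `b ℓ = w (Q ℓ)` and `q ℓ = Q ℓ - Q (ℓ-1)`. -/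
def InSafeClass (M : ℕ) (v : ℕ → ℝ) (m : ℕ) (s : Uniform) : Prop :=
  1 ≤ s.m ∧ s.m ≤ m ∧ (∀ j : ℕ, 1 ≤ j → j ≤ s.m → 0 < s.q j) ∧ s.Q s.m ≤ M ∧
  ∀ ℓ : ℕ, 1 ≤ ℓ → ℓ ≤ s.m → s.b ℓ = w v (s.Q ℓ)

/-- Membership in the class `𝒬_{≤ m}(H)` of strategies with at most `m` bid-quantity
pairs that are RoI-feasible for the bid history `H` over rounds `1,…,T`. -/
def InFeasClass (M : ℕ) (v : ℕ → ℝ) (K T : ℕ) (H : ℕ → Profile K) (m : ℕ) (s : Uniform) : Prop :=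
  s.IsUniform M ∧ s.m ≤ m ∧ ∀ t ∈ Finset.Icc 1 T, Feasible v K s.toBidVec (H t)

/-- Total value obtained by strategy `s` over the bid history `H` on rounds `1,…,T`. -/
noncomputable def totalValue (v : ℕ → ℝ) (K T : ℕ) (H : ℕ → Profile K) (s : Uniform) : ℝ :=
  ∑ t ∈ Finset.Icc 1 T, value v K s.toBidVec (H t)

/-- The optimal total value over the class `𝒫*_{≤ m}`. -/
noncomputable def bestSafe (M : ℕ) (v : ℕ → ℝ) (K T : ℕ) (H : ℕ → Profile K) (m : ℕ) : ℝ :=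
  sSup {x : ℝ | ∃ s : Uniform, InSafeClass M v m s ∧ x = totalValue v K T H s}

/-- The optimal total value over the class `𝒬_{≤ m}(H)`. -/
noncomputable def bestFeas (M : ℕ) (v : ℕ → ℝ) (K T : ℕ) (H : ℕ → Profile K) (m : ℕ) : ℝ :=
  sSup {x : ℝ | ∃ s : Uniform, InFeasClass M v K T H m s ∧ x = totalValue v K T H s}

/-- The number of units won by bidding `w v Q` on `Q` units. -/
noncomputable def unitsWon (v : ℕ → ℝ) {K : ℕ} (β : Profile K) (Q : ℕ) : ℕ :=
  open Classical in ((Icc 1 Q).filter fun r => β.c r ≤ w v Q).sup id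

/-- The total value of the safe strategy whose set of cumulative quantities is `S`. -/
noncomputable def setValue (v : ℕ → ℝ) (K T : ℕ) (H : ℕ → Profile K) (S : Finset ℕ) : ℝ :=
  ∑ t ∈ Icc 1 T, ∑ j ∈ Icc 1 (S.sup (unitsWon v (H t))), v j

/-- The set of cumulative quantities of a uniform strategy. -/
def Uniform.quantities (s : Uniform) : Finset ℕ := (Icc 1 s.m).image s.Q

lemma Uniform.Q_succ (s : Uniform) (j : ℕ) : s.Q (j + 1) = s.Q j + s.q (j + 1) := by
  simp [Uniform.Q, Finset.sum_Icc_succ_top]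

lemma Uniform.Q_mono (s : Uniform) : Monotone s.Q :=
  monotone_nat_of_le_succ fun j => by rw [s.Q_succ]; omega

lemma unitsWon_le (v : ℕ → ℝ) {K : ℕ} (β : Profile K) (Q : ℕ) : unitsWon v β Q ≤ Q := by
  classical
  refine Finset.sup_le fun r hr => ?_
  simp only [mem_filter, mem_Icc] at hr
  exact hr.1.2

lemma w_anti {M : ℕ} {v : ℕ → ℝ} (hv : ValidValuation M v) {i j : ℕ} (hi : 1 ≤ i)
    (hij : i ≤ j) (hj : j ≤ M) : w v j ≤ w v i := by
  induction j, hij using Nat.le_induction with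
  | base => exact le_rfl
  | succ n hn ih =>
    refine le_trans ?_ (ih (by omega))
    have hn0 : (0 : ℝ) < n := by exact_mod_cast (by omega : 0 < n)
    have h : (n : ℝ) * v (n + 1) ≤ ∑ ℓ ∈ Icc 1 n, v ℓ := by
      have := Finset.card_nsmul_le_sum (Icc 1 n) v (v (n + 1)) fun x hx => by
        rw [mem_Icc] at hx
        exact hv.2 x (n + 1) hx.1 (by omega) hj
      simpa using this
    unfold w
    rw [Finset.sum_Icc_succ_top (by omega), div_le_div_iff₀ (by positivity) hn0]
    push_cast
    nlinarith

lemma sum_valuation_mono {M : ℕ} {v : ℕ → ℝ} (hv : ValidValuation M v) {a b : ℕ}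
    (hab : a ≤ b) (hb : b ≤ M) : ∑ j ∈ Icc 1 a, v j ≤ ∑ j ∈ Icc 1 b, v j :=
  Finset.sum_le_sum_of_subset_of_nonneg (Icc_subset_Icc_right hab) fun j hj _ => by
    rw [mem_Icc] at hj
    exact hv.1 j hj.1 (by omega)

lemma sum_valuation_nonneg {M : ℕ} {v : ℕ → ℝ} (hv : ValidValuation M v) {b : ℕ}
    (hb : b ≤ M) : 0 ≤ ∑ j ∈ Icc 1 b, v j := by
  simpa using sum_valuation_mono hv (Nat.zero_le b) hb

/-- The allocation of a safe strategy is the best allocation among its individual pairs. -/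
lemma alloc_toBidVec {M K m : ℕ} {v : ℕ → ℝ} (hv : ValidValuation M v) (hMK : M ≤ K)
    {s : Uniform} (hs : InSafeClass M v m s) (β : Profile K) :
    alloc K s.toBidVec β = s.quantities.sup (unitsWon v β) := by
  classical
  obtain ⟨h1, -, hq, hM, hb⟩ := hs
  have key : ∀ j ℓ, 1 ≤ j → ℓ ≤ s.m → j ≤ s.Q ℓ →
      ∃ ℓ', 1 ≤ ℓ' ∧ ℓ' ≤ ℓ ∧ j ≤ s.Q ℓ' ∧ s.toBidVec.bid j = w v (s.Q ℓ') := by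
    intro j ℓ hj hℓ hjℓ
    have hmem : j ≤ s.Q (sInf {ℓ : ℕ | j ≤ s.Q ℓ}) :=
      Nat.sInf_mem (s := {ℓ : ℕ | j ≤ s.Q ℓ}) ⟨ℓ, hjℓ⟩
    have hle : sInf {ℓ : ℕ | j ≤ s.Q ℓ} ≤ ℓ := Nat.sInf_le hjℓ
    have hpos : 1 ≤ sInf {ℓ : ℕ | j ≤ s.Q ℓ} := by
      by_contra hlt
      rw [Nat.lt_one_iff.mp (not_le.mp hlt)] at hmem
      simp [Uniform.Q] at hmem
      omega
    exact ⟨_, hpos, hle, hmem, hb _ hpos (hle.trans hℓ)⟩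
  apply le_antisymm
  · refine Finset.sup_le fun r hr => ?_
    simp only [mem_filter, mem_Icc, le_min_iff] at hr
    obtain ⟨⟨hr1, hrn, -⟩, hr⟩ := hr
    obtain ⟨ℓ, hℓ1, hℓm, hrℓ, hbid⟩ := key r s.m hr1 le_rfl hrn
    have h : r ≤ unitsWon v β (s.Q ℓ) := by
      refine Finset.le_sup (f := id) ?_
      simp only [mem_filter, mem_Icc]
      exact ⟨⟨hr1, hrℓ⟩, hbid ▸ hr r ⟨hr1, le_rfl⟩⟩
    exact h.trans (Finset.le_sup (mem_image_of_mem _ (mem_Icc.2 ⟨hℓ1, hℓm⟩)))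
  · refine Finset.sup_le fun Q hQ => ?_
    obtain ⟨ℓ, hℓ, rfl⟩ := mem_image.1 hQ
    rw [mem_Icc] at hℓ
    refine Finset.sup_le fun r hr => ?_
    simp only [mem_filter, mem_Icc] at hr
    have hQm := s.Q_mono hℓ.2
    refine Finset.le_sup (f := id) ?_
    simp only [mem_filter, mem_Icc, le_min_iff]
    refine ⟨⟨hr.1.1, hr.1.2.trans hQm, by omega⟩, fun j hj => ?_⟩
    obtain ⟨ℓ', hℓ'1, hℓ'ℓ, hjℓ', hbid⟩ := key j ℓ hj.1 hℓ.2 (hj.2.trans hr.1.2)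
    rw [hbid]
    exact ((β.mono j r hj.1 hj.2 (by omega)).trans hr.2).trans
      (w_anti hv (hj.1.trans hjℓ') (s.Q_mono hℓ'ℓ) (hQm.trans hM))

lemma totalValue_eq_setValue {M K m : ℕ} {v : ℕ → ℝ} (hv : ValidValuation M v) (hMK : M ≤ K)
    {s : Uniform} (hs : InSafeClass M v m s) (T : ℕ) (H : ℕ → Profile K) :
    totalValue v K T H s = setValue v K T H s.quantities := by
  simp only [totalValue, setValue, value, alloc_toBidVec hv hMK hs]

lemma InSafeClass.quantities_nonempty {M m : ℕ} {v : ℕ → ℝ} {s : Uniform}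
    (hs : InSafeClass M v m s) : s.quantities.Nonempty :=
  ⟨s.Q 1, mem_image_of_mem _ (mem_Icc.2 ⟨le_rfl, hs.1⟩)⟩

lemma InSafeClass.quantities_subset {M m : ℕ} {v : ℕ → ℝ} {s : Uniform}
    (hs : InSafeClass M v m s) : s.quantities ⊆ Icc 1 M := by
  intro Q hQ
  obtain ⟨ℓ, hℓ, rfl⟩ := mem_image.1 hQ
  rw [mem_Icc] at hℓ ⊢
  obtain ⟨k, rfl⟩ : ∃ k, ℓ = k + 1 := ⟨ℓ - 1, by omega⟩
  have := hs.2.2.1 (k + 1) hℓ.1 hℓ.2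
  exact ⟨by rw [s.Q_succ]; omega, (s.Q_mono hℓ.2).trans hs.2.2.2.1⟩

lemma InSafeClass.card_quantities_le {M m : ℕ} {v : ℕ → ℝ} {s : Uniform}
    (hs : InSafeClass M v m s) : s.quantities.card ≤ m := by
  refine Finset.card_image_le.trans ?_
  simpa using hs.2.1

/-- Every nonempty set of at most `m` quantities comes from a safe strategy. -/
lemma exists_inSafeClass {M m : ℕ} (v : ℕ → ℝ) {S : Finset ℕ} (hS : S.Nonempty)
    (hSM : S ⊆ Icc 1 M) (hcard : S.card ≤ m) :
    ∃ s : Uniform, InSafeClass M v m s ∧ s.quantities = S := by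
  classical
  set f : ℕ → ℕ := fun j => if j = 0 then 0 else Nat.nth (· ∈ S) (j - 1) with hf
  have hfin : {x | x ∈ S}.Finite := S.finite_toSet
  have hfc : hfin.toFinset = S := by ext; rw [Set.Finite.mem_toFinset]; rfl
  have hfmem : ∀ j, 1 ≤ j → j ≤ S.card → f j ∈ S := by
    intro j h1 h2
    have := Nat.nth_mem_of_lt_card hfin (n := j - 1) (by rw [hfc]; omega)
    simpa [hf, show j ≠ 0 by omega] using this
  have hlt : ∀ j, j < S.card → f j < f (j + 1) := by
    intro j hj
    rcases Nat.eq_zero_or_pos j with rfl | h0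
    · have := mem_Icc.1 (hSM (hfmem 1 le_rfl (by omega)))
      simpa [hf, Nat.succ_le_iff] using this.1
    · have := Nat.nth_lt_nth_of_lt_card hfin (m := j - 1) (n := j) (by omega)
        (by rw [hfc]; omega)
      simpa [hf, show j ≠ 0 by omega] using this
  set s : Uniform := ⟨S.card, fun j => w v (∑ ℓ ∈ Icc 1 j, (f ℓ - f (ℓ - 1))),
    fun j => f j - f (j - 1)⟩ with hs
  have hQ : ∀ j, j ≤ S.card → s.Q j = f j := by
    intro j hj
    induction j with
    | zero => simp [Uniform.Q, hf]
    | succ k ih =>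
      rw [s.Q_succ, ih (by omega)]
      have := hlt k (by omega)
      simp only [hs, Nat.add_sub_cancel]
      omega
  refine ⟨s, ⟨hS.card_pos, hcard, fun j h1 h2 => ?_, ?_, fun ℓ _ _ => rfl⟩, ?_⟩
  · obtain ⟨k, rfl⟩ : ∃ k, j = k + 1 := ⟨j - 1, by omega⟩
    have := hlt k h2
    simp only [hs, Nat.add_sub_cancel]
    omega
  · rw [hQ _ le_rfl]
    exact (mem_Icc.1 (hSM (hfmem _ hS.card_pos le_rfl))).2
  · ext Q
    simp only [Uniform.quantities, mem_image, mem_Icc]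
    constructor
    · rintro ⟨j, ⟨h1, h2⟩, rfl⟩
      rw [hQ j h2]
      exact hfmem j h1 h2
    · intro hQS
      obtain ⟨n, hn, hnQ⟩ := Nat.exists_lt_card_finite_nth_eq hfin hQS
      rw [hfc] at hn
      refine ⟨n + 1, ⟨by omega, by simp only [hs]; omega⟩, ?_⟩
      rw [hQ _ (by omega)]
      simpa [hf] using hnQ

lemma exists_mem_sup_unitsWon (v : ℕ → ℝ) {K : ℕ} (β : Profile K) {S : Finset ℕ}
    (hS : S.Nonempty) : ∃ Q ∈ S, S.sup (unitsWon v β) = unitsWon v β Q :=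
  Finset.exists_mem_eq_sup S hS _

lemma sup_unitsWon_le {M : ℕ} (v : ℕ → ℝ) {K : ℕ} (β : Profile K) {S : Finset ℕ}
    (hSM : S ⊆ Icc 1 M) : S.sup (unitsWon v β) ≤ M :=
  Finset.sup_le fun Q hQ => (unitsWon_le v β Q).trans (mem_Icc.1 (hSM hQ)).2

lemma setValue_nonneg {M K : ℕ} {v : ℕ → ℝ} (hv : ValidValuation M v) (T : ℕ)
    (H : ℕ → Profile K) {S : Finset ℕ} (hSM : S ⊆ Icc 1 M) : 0 ≤ setValue v K T H S :=
  Finset.sum_nonneg fun _ _ => sum_valuation_nonneg hv (sup_unitsWon_le v _ hSM)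

lemma setValue_le_bestSafe {M K m : ℕ} {v : ℕ → ℝ} (hv : ValidValuation M v) (hMK : M ≤ K)
    (T : ℕ) (H : ℕ → Profile K) {S : Finset ℕ} (hS : S.Nonempty) (hSM : S ⊆ Icc 1 M)
    (hcard : S.card ≤ m) : setValue v K T H S ≤ bestSafe M v K T H m := by
  obtain ⟨s, hs, rfl⟩ := exists_inSafeClass v hS hSM hcard
  refine le_csSup ?_ ⟨s, hs, (totalValue_eq_setValue hv hMK hs T H).symm⟩
  refine (((Icc 1 M).powerset.image (setValue v K T H)).finite_toSet.subset ?_).bddAbove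
  rintro x ⟨s', hs', rfl⟩
  rw [totalValue_eq_setValue hv hMK hs' T H]
  exact mem_coe.2 (mem_image_of_mem _ (mem_powerset.2 hs'.quantities_subset))

lemma bestSafe_le {M K m : ℕ} {v : ℕ → ℝ} (hv : ValidValuation M v) (hMK : M ≤ K)
    (T : ℕ) (H : ℕ → Profile K) {B : ℝ} (hB : 0 ≤ B)
    (h : ∀ S : Finset ℕ, S.Nonempty → S ⊆ Icc 1 M → S.card ≤ m → setValue v K T H S ≤ B) :
    bestSafe M v K T H m ≤ B := by
  refine Real.sSup_le ?_ hB
  rintro x ⟨s, hs, rfl⟩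
  rw [totalValue_eq_setValue hv hMK hs T H]
  exact h _ hs.quantities_nonempty hs.quantities_subset hs.card_quantities_le

lemma bestSafe_nonneg {M K m : ℕ} {v : ℕ → ℝ} (hv : ValidValuation M v) (hMK : M ≤ K)
    (T : ℕ) (H : ℕ → Profile K) : 0 ≤ bestSafe M v K T H m := by
  refine Real.sSup_nonneg ?_
  rintro x ⟨s, hs, rfl⟩
  rw [totalValue_eq_setValue hv hMK hs T H]
  exact setValue_nonneg hv T H hs.quantities_subset

/-- Some `m`-element subset carries at least its proportional share of a sum. -/
lemma exists_subset_card_mul_sum_le {ι : Type*} (A : ι → ℝ) (S : Finset ι)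
    {m : ℕ} (hm : 1 ≤ m) (hmS : m ≤ S.card) :
    ∃ S' ⊆ S, S'.card = m ∧ (m : ℝ) * ∑ i ∈ S, A i ≤ (S.card : ℝ) * ∑ i ∈ S', A i := by
  classical
  induction S using Finset.strongInduction with
  | H S ih =>
    rcases hmS.eq_or_lt with rfl | hlt
    · exact ⟨S, subset_rfl, rfl, le_rfl⟩
    obtain ⟨e, he, hle⟩ := S.exists_min_image A (Finset.card_pos.1 (by omega))
    have hce : (S.erase e).card = S.card - 1 := Finset.card_erase_of_mem he
    obtain ⟨S', hS', hc, hsum⟩ := ih _ (Finset.erase_ssubset he) (by omega)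
    refine ⟨S', hS'.trans (Finset.erase_subset _ _), hc, ?_⟩
    have hmin : (S.card : ℝ) * A e ≤ ∑ i ∈ S, A i := by
      simpa using Finset.card_nsmul_le_sum S A (A e) hle
    rw [hce, Nat.cast_sub (by omega), Nat.cast_one] at hsum
    have hsplit := Finset.add_sum_erase S A he
    have hk : (1 : ℝ) < S.card := by exact_mod_cast (by omega : 1 < S.card)
    have hm0 : (0 : ℝ) ≤ m := by positivity
    have h1 : ((S.card : ℝ) - 1) * ∑ i ∈ S, A i ≤ S.card * ∑ i ∈ S.erase e, A i := by
      rw [← hsplit] at hmin ⊢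
      linarith
    have h2 := mul_le_mul_of_nonneg_left h1 hm0
    have h3 := mul_le_mul_of_nonneg_left hsum (by linarith : (0 : ℝ) ≤ S.card)
    refine le_of_mul_le_mul_left ?_ (by linarith : (0 : ℝ) < S.card - 1)
    linarith

lemma exists_subset_setValue {M K m T : ℕ} {v : ℕ → ℝ} (hv : ValidValuation M v)
    (H : ℕ → Profile K) {S : Finset ℕ} (hSM : S ⊆ Icc 1 M) (hm : 1 ≤ m) (hmS : m ≤ S.card) :
    ∃ S' ⊆ S, S'.card = m ∧
      (m : ℝ) * setValue v K T H S ≤ (S.card : ℝ) * setValue v K T H S' := by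
  classical
  have hS : S.Nonempty := Finset.card_pos.1 (by omega)
  choose e heS he using fun t => exists_mem_sup_unitsWon v (H t) hS
  set g : ℕ → ℝ := fun t => ∑ j ∈ Icc 1 (unitsWon v (H t) (e t)), v j with hg
  set A : ℕ → ℝ := fun Q => ∑ t ∈ Icc 1 T, if e t = Q then g t else 0 with hA
  have hsum : ∀ R : Finset ℕ, ∑ Q ∈ R, A Q = ∑ t ∈ Icc 1 T, if e t ∈ R then g t else 0 := by
    intro R
    simp only [hA]
    rw [Finset.sum_comm]
    simp only [Finset.sum_ite_eq]
  have hFS : ∑ Q ∈ S, A Q = setValue v K T H S := by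
    rw [hsum]
    refine Finset.sum_congr rfl fun t _ => ?_
    rw [if_pos (heS t), he t]
  obtain ⟨S', hS', hc, hle⟩ := exists_subset_card_mul_sum_le A S hm hmS
  refine ⟨S', hS', hc, ?_⟩
  rw [← hFS]
  refine hle.trans (mul_le_mul_of_nonneg_left ?_ (by positivity))
  rw [hsum]
  refine Finset.sum_le_sum fun t _ => ?_
  have hM := sup_unitsWon_le v (H t) (hS'.trans hSM)
  split_ifs with h
  · exact sum_valuation_mono hv (Finset.le_sup (f := unitsWon v (H t)) h) hM
  · exact sum_valuation_nonneg hv hM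

theorem bestSafe_le_mul_bestSafe {m m' : ℕ} (hm : 1 ≤ m) (hmm' : m ≤ m') {K M : ℕ} (T : ℕ)
    {v : ℕ → ℝ} (hv : ValidValuation M v) (hMK : M ≤ K) (H : ℕ → Profile K) :
    bestSafe M v K T H m' ≤ ((m' : ℝ) / (m : ℝ)) * bestSafe M v K T H m := by
  have hm0 : (0 : ℝ) < m := by exact_mod_cast hm
  have hb := bestSafe_nonneg (m := m) hv hMK T H
  refine bestSafe_le hv hMK T H (by positivity) fun S hS hSM hcard => ?_
  rw [div_mul_eq_mul_div, le_div_iff₀ hm0, mul_comm]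
  rcases le_total S.card m with h | h
  · have hle := setValue_le_bestSafe hv hMK T H hS hSM h
    have hm'' : (m : ℝ) ≤ m' := by exact_mod_cast hmm'
    exact mul_le_mul hm'' hle (setValue_nonneg hv T H hSM) (by positivity)
  · obtain ⟨S', hS', hc, hle⟩ := exists_subset_setValue (T := T) hv H hSM hm h
    have hle' := setValue_le_bestSafe hv hMK T H (Finset.card_pos.1 (by omega))
      (hS'.trans hSM) hc.le
    have hc' : (S.card : ℝ) ≤ m' := by exact_mod_cast hcard
    refine hle.trans (mul_le_mul hc' hle' (setValue_nonneg hv T H (hS'.trans hSM))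
      (by positivity))

/-- A valuation whose cumulative value of `Q ≥ 1` units is `Q + 1`. -/
def bumpValuation (j : ℕ) : ℝ := if j = 1 then 2 else 1

lemma bumpValuation_valid (M : ℕ) : ValidValuation M bumpValuation := by
  constructor
  · intro j _ _
    unfold bumpValuation
    split_ifs <;> norm_num
  · intro i j _ _ _
    unfold bumpValuation
    split_ifs <;> first | omega | norm_num

lemma sum_bumpValuation {Q : ℕ} (hQ : 1 ≤ Q) : ∑ j ∈ Icc 1 Q, bumpValuation j = Q + 1 := by
  induction Q, hQ using Nat.le_induction with
  | base => norm_num [bumpValuation]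
  | succ n hn ih =>
    rw [Finset.sum_Icc_succ_top (by omega), ih]
    simp [bumpValuation, show n ≠ 0 by omega]

/-- The profile against which, under `bumpValuation`, a bid on `Q` units wins exactly
when `t * (Q + 1) ≤ N`. -/
noncomputable def hyperbolaProfile (N t K : ℕ) : Profile K where
  c _ := (N : ℝ) / |(N : ℝ) - t|
  mono _ _ _ _ _ := le_rfl
  nonneg _ _ _ := by positivity

lemma unitsWon_hyperbolaProfile {N t K Q : ℕ} (ht : t < N) (hQ : 1 ≤ Q) :
    unitsWon bumpValuation (hyperbolaProfile N t K) Q = if t * (Q + 1) ≤ N then Q else 0 := by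
  classical
  have hNt : (0 : ℝ) < (N : ℝ) - t := by
    rw [sub_pos]; exact_mod_cast ht
  have hQ0 : (0 : ℝ) < Q := by exact_mod_cast hQ
  have hiff : (N : ℝ) / |(N : ℝ) - t| ≤ w bumpValuation Q ↔ t * (Q + 1) ≤ N := by
    rw [w, sum_bumpValuation hQ, abs_of_pos hNt, div_le_div_iff₀ hNt hQ0,
      ← Nat.cast_le (α := ℝ)]
    push_cast
    constructor <;> intro h <;> linarith
  simp only [unitsWon, hyperbolaProfile, hiff]
  split_ifs with h
  · refine le_antisymm (Finset.sup_le fun r hr => ?_) (Finset.le_sup (f := id) ?_)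
    · simp only [mem_filter, mem_Icc] at hr
      exact hr.1.2
    · simp [h, hQ]
  · simp [h]

lemma setValue_hyperbolaProfile_le {N K T : ℕ} (hT : T < N) {S : Finset ℕ}
    (hS : S.Nonempty) (hSM : ∀ Q ∈ S, 1 ≤ Q) :
    setValue bumpValuation K T (fun t => hyperbolaProfile N t K) S ≤ S.card * N := by
  have hpt : ∀ t ∈ Icc 1 T, ∑ j ∈ Icc 1 (S.sup (unitsWon bumpValuation
      (hyperbolaProfile N t K))), bumpValuation j ≤
      ∑ Q ∈ S, if t * (Q + 1) ≤ N then (Q + 1 : ℝ) else 0 := by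
    intro t ht
    rw [mem_Icc] at ht
    obtain ⟨Q, hQS, hQ⟩ := exists_mem_sup_unitsWon bumpValuation (hyperbolaProfile N t K) hS
    rw [hQ, unitsWon_hyperbolaProfile (by omega) (hSM Q hQS)]
    refine le_trans ?_ (Finset.single_le_sum
      (f := fun Q : ℕ => if t * (Q + 1) ≤ N then (Q + 1 : ℝ) else 0)
      (fun Q _ => by positivity) hQS)
    split_ifs with h
    · simp [sum_bumpValuation (hSM Q hQS)]
    · simp
  refine (Finset.sum_le_sum hpt).trans ?_
  rw [Finset.sum_comm, ← nsmul_eq_mul]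
  refine Finset.sum_le_card_nsmul _ _ _ fun Q _ => ?_
  rw [← Finset.sum_filter, Finset.sum_const, nsmul_eq_mul]
  have hc : ((Icc 1 T).filter fun t => t * (Q + 1) ≤ N).card ≤ N / (Q + 1) := by
    calc _ ≤ (Icc 1 (N / (Q + 1))).card := by
          refine Finset.card_le_card fun t ht => ?_
          simp only [mem_filter, mem_Icc] at ht ⊢
          exact ⟨ht.1.1, (Nat.le_div_iff_mul_le (by omega)).2 ht.2⟩
      _ = _ := by simp
  have := (Nat.mul_le_mul_right (Q + 1) hc).trans (Nat.div_mul_le_self N (Q + 1))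
  exact_mod_cast this

lemma le_setValue_hyperbolaProfile {R n K : ℕ} (hR : 2 ≤ R) (hn : 1 ≤ n) :
    (n : ℝ) * (R ^ n - R ^ (n - 1)) ≤ setValue bumpValuation K (R ^ (n - 1))
      (fun t => hyperbolaProfile (R ^ n) t K) ((Icc 1 n).image fun u => R ^ u - 1) := by
  set S := (Icc 1 n).image fun u => R ^ u - 1 with hS
  have hR1 : (1 : ℝ) ≤ R := by exact_mod_cast (by omega : 1 ≤ R)
  have hpow : ∀ u, 1 ≤ u → 2 ≤ R ^ u := fun u hu => hR.trans (Nat.le_self_pow (by omega) R)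
  have hpt : ∀ t ∈ Icc 1 (R ^ (n - 1)),
      (∑ u ∈ Icc 1 n, if t ≤ R ^ (n - u) then ((R : ℝ) ^ u - R ^ (u - 1)) else 0) ≤
      ∑ j ∈ Icc 1 (S.sup (unitsWon bumpValuation (hyperbolaProfile (R ^ n) t K))),
        bumpValuation j := by
    intro t ht
    rw [mem_Icc] at ht
    obtain ⟨u, hu, hmax⟩ := ((Icc 1 n).filter fun u => t ≤ R ^ (n - u)).exists_max_image id
      ⟨1, by simp [hn, ht.2]⟩
    simp only [mem_filter, mem_Icc, id] at hu hmax
    have htel : ∀ k : ℕ, ∑ i ∈ Icc 1 k, ((R : ℝ) ^ i - R ^ (i - 1)) = R ^ k - 1 := by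
      intro k
      induction k with
      | zero => simp
      | succ k ih => rw [Finset.sum_Icc_succ_top (by omega), ih]; simp
    have hsub : (Icc 1 n).filter (fun u => t ≤ R ^ (n - u)) ⊆ Icc 1 u := by
      intro i hi
      simp only [mem_filter, mem_Icc] at hi ⊢
      exact ⟨hi.1.1, hmax i hi⟩
    have hlow : (∑ i ∈ Icc 1 n, if t ≤ R ^ (n - i) then ((R : ℝ) ^ i - R ^ (i - 1)) else 0)
        ≤ R ^ u - 1 := by
      rw [← Finset.sum_filter, ← htel]
      refine Finset.sum_le_sum_of_subset_of_nonneg hsub fun i _ _ => ?_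
      rw [sub_nonneg]
      exact pow_le_pow_right₀ hR1 (by omega)
    have hu2 := hpow u hu.1.1
    have htn : t < R ^ n := ht.2.trans_lt (Nat.pow_lt_pow_right (by omega) (by omega))
    have hwin : unitsWon bumpValuation (hyperbolaProfile (R ^ n) t K) (R ^ u - 1)
        = R ^ u - 1 := by
      rw [unitsWon_hyperbolaProfile htn (by omega), if_pos]
      rw [Nat.sub_add_cancel (by omega)]
      calc t * R ^ u ≤ R ^ (n - u) * R ^ u := Nat.mul_le_mul_right _ hu.2
        _ = R ^ n := by rw [← pow_add, Nat.sub_add_cancel hu.1.2]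
    have hle : R ^ u - 1 ≤ S.sup (unitsWon bumpValuation (hyperbolaProfile (R ^ n) t K)) := by
      conv_lhs => rw [← hwin]
      exact Finset.le_sup (mem_image_of_mem (fun u => R ^ u - 1) (mem_Icc.2 hu.1))
    refine (hlow.trans ?_).trans (sum_valuation_mono (bumpValuation_valid _) hle le_rfl)
    rw [sum_bumpValuation (by omega), Nat.cast_sub (by omega)]
    push_cast
    linarith
  refine le_trans (le_of_eq ?_) (Finset.sum_le_sum hpt)
  rw [Finset.sum_comm]
  have hterm : ∀ u ∈ Icc 1 n, (∑ t ∈ Icc 1 (R ^ (n - 1)),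
      if t ≤ R ^ (n - u) then ((R : ℝ) ^ u - R ^ (u - 1)) else 0) = R ^ n - R ^ (n - 1) := by
    intro u hu
    rw [mem_Icc] at hu
    have hfil : (Icc 1 (R ^ (n - 1))).filter (fun t => t ≤ R ^ (n - u)) =
        Icc 1 (R ^ (n - u)) := by
      have : R ^ (n - u) ≤ R ^ (n - 1) := Nat.pow_le_pow_right (by omega) (by omega)
      ext t
      simp only [mem_filter, mem_Icc]
      omega
    rw [← Finset.sum_filter, hfil, Finset.sum_const, nsmul_eq_mul, Nat.card_Icc,
      Nat.add_sub_cancel, Nat.cast_pow, mul_sub, ← pow_add, ← pow_add]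
    congr 2 <;> omega
  rw [Finset.sum_congr rfl hterm, Finset.sum_const, nsmul_eq_mul, Nat.card_Icc,
    Nat.add_sub_cancel]

/-- Theorem `thm:m-mbar`: for `m ≤ m'`, the optimal value over safe
undominated strategies with at most `m'` pairs is at most `m'/m` times that over safe
undominated strategies with at most `m` pairs, and this factor is tight. -/
theorem richness_safe_classes (m m' : ℕ) (hm : 1 ≤ m) (hmm' : m ≤ m') :
    (∀ (K M T : ℕ) (v : ℕ → ℝ), ValidValuation M v → M ≤ K → ∀ H : ℕ → Profile K,
      bestSafe M v K T H m' ≤ ((m' : ℝ) / (m : ℝ)) * bestSafe M v K T H m) ∧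
    (∀ δ : ℝ, 0 < δ → δ ≤ 1 / 2 →
      ∃ (T K M : ℕ) (v : ℕ → ℝ) (H : ℕ → Profile K),
        1 ≤ T ∧ 1 ≤ K ∧ 1 ≤ M ∧ M ≤ K ∧ ValidValuation M v ∧
        0 < bestSafe M v K T H m ∧
        ∃ s : Uniform, InSafeClass M v m' s ∧
          ((m' : ℝ) / (m : ℝ) - δ) * bestSafe M v K T H m ≤ totalValue v K T H s) := by
  refine ⟨fun K M T v hv hMK H => bestSafe_le_mul_bestSafe hm hmm' T hv hMK H, ?_⟩
  intro δ hδ hδ2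
  obtain ⟨R₀, hR₀⟩ := exists_nat_ge ((m' : ℝ) / δ)
  set R := R₀ + 2 with hRdef
  have hR : 2 ≤ R := by omega
  have hRδ : (m' : ℝ) ≤ R * δ := by
    rw [div_le_iff₀ hδ] at hR₀
    rw [hRdef]
    push_cast
    nlinarith
  have hm' : 1 ≤ m' := hm.trans hmm'
  have hlt : R ^ (m' - 1) < R ^ m' := Nat.pow_lt_pow_right (by omega) (by omega)
  have hT : 1 ≤ R ^ (m' - 1) := Nat.one_le_pow _ _ (by omega)
  set N := R ^ m' with hN
  set H : ℕ → Profile (N - 1) := fun t => hyperbolaProfile N t (N - 1) with hH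
  have hv := bumpValuation_valid (N - 1)
  set S : Finset ℕ := (Icc 1 m').image fun u => R ^ u - 1 with hS
  have hSne : S.Nonempty := ⟨R ^ 1 - 1, mem_image_of_mem _ (mem_Icc.2 ⟨le_rfl, hm'⟩)⟩
  have hSM : S ⊆ Icc 1 (N - 1) := by
    intro Q hQ
    obtain ⟨u, hu, rfl⟩ := mem_image.1 hQ
    rw [mem_Icc] at hu ⊢
    have h1 : R ≤ R ^ u := Nat.le_self_pow (by omega) R
    have h2 : R ^ u ≤ N := Nat.pow_le_pow_right (by omega) hu.2
    omega
  have hScard : S.card ≤ m' := Finset.card_image_le.trans (by simp)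
  have hgood := le_setValue_hyperbolaProfile (K := N - 1) hR hm'
  have hgap : (0 : ℝ) < (R : ℝ) ^ m' - R ^ (m' - 1) := by
    rw [sub_pos]
    exact_mod_cast hlt
  have hm0 : (0 : ℝ) < m := by exact_mod_cast hm
  have hm'0 : (0 : ℝ) < m' := by exact_mod_cast hm'
  have hmmR : (m : ℝ) ≤ m' := by exact_mod_cast hmm'
  have hmR : (1 : ℝ) ≤ m := by exact_mod_cast hm
  have hbest : bestSafe (N - 1) bumpValuation (N - 1) (R ^ (m' - 1)) H m ≤ m * N := by
    refine bestSafe_le hv le_rfl _ H (by positivity) fun S' hS' hS'M hc => ?_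
    refine (setValue_hyperbolaProfile_le hlt hS' fun Q hQ => (mem_Icc.1 (hS'M hQ)).1).trans ?_
    exact mul_le_mul_of_nonneg_right (by exact_mod_cast hc) (by positivity)
  obtain ⟨s, hs, hsS⟩ := exists_inSafeClass bumpValuation hSne hSM hScard
  refine ⟨R ^ (m' - 1), N - 1, N - 1, bumpValuation, H, hT, by omega, by omega, le_rfl, hv,
    ?_, s, hs, ?_⟩
  · have h1 := setValue_le_bestSafe hv le_rfl (R ^ (m' - 1)) H hSne hSM hScard
    have h2 := bestSafe_le_mul_bestSafe hm hmm' (R ^ (m' - 1)) hv le_rfl H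
    have h3 := (mul_pos hm'0 hgap).trans_le (hgood.trans (h1.trans h2))
    exact pos_of_mul_pos_right h3 (by positivity)
  · rw [totalValue_eq_setValue hv le_rfl hs, hsS]
    refine le_trans ?_ hgood
    have hcoef : 0 ≤ (m' : ℝ) / m - δ := by
      have : (1 : ℝ) ≤ (m' : ℝ) / m := (one_le_div hm0).2 hmmR
      linarith
    refine (mul_le_mul_of_nonneg_left hbest hcoef).trans ?_
    have hpow : (R : ℝ) ^ m' = R ^ (m' - 1) * R := by
      rw [← pow_succ, Nat.sub_add_cancel hm']
    have hP : (0 : ℝ) < (R : ℝ) ^ (m' - 1) := by positivity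
    have hδm : (R : ℝ) * δ ≤ R * δ * m := le_mul_of_one_le_right (by positivity) hmR
    have hexp : ((m' : ℝ) / m - δ) * (m * N) = (m' - δ * m) * N := by field_simp
    rw [hexp, hN, Nat.cast_pow, hpow]
    nlinarith [mul_le_mul_of_nonneg_left (hRδ.trans hδm) hP.le]

end Auction
end

section
/- Richness ratio between RoI-feasible classes: for all m, m' ∈ ℕ with m ≤ m', every bid history H₋ = (β₋^1,…,β₋^T) and every valuation vector v, sup_{b' ∈ 𝒬_{≤m'}(H₋)} ∑_{t=1}^{T} V(b';β₋^t) ≤ (m'/m) · sup_{b ∈ 𝒬_{≤m}(H₋)} ∑_{t=1}^{T} V(b;β₋^t). -/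
open Finset

namespace Auction

section Alloc

variable {K : ℕ} {b b' : BidVec} {β : Profile K}

theorem alloc_spec (K : ℕ) (b : BidVec) (β : Profile K) :
    alloc K b β ≤ min b.n K ∧ ∀ j ∈ Finset.Icc 1 (alloc K b β), β.c j ≤ b.bid j := by
  unfold alloc
  refine Finset.sup_induction (p := fun r => r ≤ min b.n K ∧
    ∀ j ∈ Finset.Icc 1 r, β.c j ≤ b.bid j) ?_ ?_ ?_
  · simp
  · intro x hx y hy
    rcases le_total x y with h | h
    · simpa [sup_eq_right.2 h] using hy
    · simpa [sup_eq_left.2 h] using hx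
  · intro r hr
    simp only [Finset.mem_filter, Finset.mem_Icc] at hr ⊢
    exact ⟨hr.1.2, hr.2⟩

theorem le_alloc {r : ℕ} (hr : r ≤ min b.n K)
    (h : ∀ j ∈ Finset.Icc 1 r, β.c j ≤ b.bid j) : r ≤ alloc K b β := by
  rcases Nat.eq_zero_or_pos r with rfl | hpos
  · exact Nat.zero_le _
  · unfold alloc
    refine Finset.le_sup (f := id) ?_
    simp only [Finset.mem_filter]
    exact ⟨Finset.mem_Icc.2 ⟨hpos, hr⟩, h⟩

theorem alloc_mono (hn : b'.n ≤ b.n) (hbid : ∀ i, 1 ≤ i → i ≤ b'.n → b'.bid i ≤ b.bid i) :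
    alloc K b' β ≤ alloc K b β := by
  obtain ⟨h1, h2⟩ := alloc_spec K b' β
  refine le_alloc (h1.trans (min_le_min_right _ hn)) fun j hj => (h2 j hj).trans ?_
  rw [Finset.mem_Icc] at hj
  exact hbid j hj.1 (hj.2.trans (h1.trans (min_le_left _ _)))

/-- Lowering bids does not lose units as long as the last winning bid is kept. -/
theorem alloc_le_of_bid_eq (hanti : ∀ i j, 1 ≤ i → i ≤ j → j ≤ b'.n → b'.bid j ≤ b'.bid i)
    (hn : alloc K b β ≤ b'.n) (heq : b'.bid (alloc K b β) = b.bid (alloc K b β)) :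
    alloc K b β ≤ alloc K b' β := by
  obtain ⟨h1, h2⟩ := alloc_spec K b β
  have hK := h1.trans (min_le_right _ _)
  refine le_alloc (le_min hn hK) fun j hj => ?_
  rw [Finset.mem_Icc] at hj
  calc β.c j ≤ β.c (alloc K b β) := β.mono _ _ hj.1 hj.2 hK
    _ ≤ b.bid (alloc K b β) := h2 _ (Finset.mem_Icc.2 ⟨hj.1.trans hj.2, le_rfl⟩)
    _ = b'.bid (alloc K b β) := heq.symm
    _ ≤ b'.bid j := hanti _ _ hj.1 hj.2 hn

theorem price_mono (hn : b'.n ≤ b.n) (hbid : ∀ i, 1 ≤ i → i ≤ b'.n → b'.bid i ≤ b.bid i)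
    (hpos : 0 < alloc K b' β) : price K b' β ≤ price K b β := by
  have hle : alloc K b' β ≤ alloc K b β := alloc_mono hn hbid
  obtain ⟨h1, h2⟩ := alloc_spec K b β
  have hK := h1.trans (min_le_right _ _)
  have hn' := (alloc_spec K b' β).1.trans (min_le_left _ _)
  unfold price
  rw [if_neg hpos.ne', if_neg (hpos.trans_le hle).ne']
  rcases hle.eq_or_lt with heq | hlt
  · rw [← heq]
    have hb := hbid _ hpos hn'
    split_ifs with h
    · exact min_le_min_right _ hb
    · have hK' : alloc K b' β = K := by omega
      rwa [hK'] at hb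
  · rw [if_pos (hlt.trans_le hK)]
    refine (min_le_right _ _).trans ((β.mono _ (alloc K b β) (by omega) hlt hK).trans ?_)
    have hr := h2 _ (Finset.mem_Icc.2 ⟨hpos.trans_le hle, le_rfl⟩)
    split_ifs with h
    · exact le_min hr (β.mono _ _ (hpos.trans_le hle) (Nat.le_succ _) h)
    · have hK' : alloc K b β = K := by omega
      rwa [hK'] at hr ⊢

end Alloc

section Valuation

variable {M : ℕ} {v : ℕ → ℝ}

theorem mul_sum_le_mul_sum (hv : ValidValuation M v) {r' r : ℕ} (hle : r' ≤ r) (hr : r ≤ M) :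
    (r' : ℝ) * ∑ j ∈ Finset.Icc 1 r, v j ≤ (r : ℝ) * ∑ j ∈ Finset.Icc 1 r', v j := by
  induction r, hle using Nat.le_induction with
  | base => exact le_rfl
  | succ n hn ih =>
    have h1 : (r' : ℝ) * v (n + 1) ≤ ∑ j ∈ Finset.Icc 1 r', v j := by
      have := Finset.card_nsmul_le_sum (Finset.Icc 1 r') v (v (n + 1)) fun j hj => by
        rw [Finset.mem_Icc] at hj
        exact hv.2 _ _ hj.1 (by omega) hr
      simpa using this
    rw [Finset.sum_Icc_succ_top (by omega)]
    push_cast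
    linarith [ih (by omega)]

theorem value_nonneg (hv : ValidValuation M v) {K : ℕ} {b : BidVec} (hb : b.n ≤ M)
    (β : Profile K) : 0 ≤ value v K b β := by
  refine Finset.sum_nonneg fun j hj => ?_
  rw [Finset.mem_Icc] at hj
  have := (alloc_spec K b β).1
  exact hv.1 j hj.1 (by omega)

theorem value_le_sum (hv : ValidValuation M v) {K : ℕ} {b : BidVec} (hb : b.n ≤ M)
    (β : Profile K) : value v K b β ≤ ∑ j ∈ Finset.Icc 1 M, v j := by
  have := (alloc_spec K b β).1
  refine Finset.sum_le_sum_of_subset_of_nonneg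
    (Finset.Icc_subset_Icc_right (by omega)) fun j hj _ => ?_
  rw [Finset.mem_Icc] at hj
  exact hv.1 j hj.1 hj.2

/-- The RoI constraint is preserved when bids are lowered or dropped. -/
theorem Feasible.of_le (hv : ValidValuation M v) {K : ℕ} {b b' : BidVec} {β : Profile K}
    (hb : b.n ≤ M) (hn : b'.n ≤ b.n)
    (hbid : ∀ i, 1 ≤ i → i ≤ b'.n → b'.bid i ≤ b.bid i) (h : Feasible v K b β) :
    Feasible v K b' β := by
  unfold Feasible payment at *
  rcases Nat.eq_zero_or_pos (alloc K b' β) with h0 | hpos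
  · rw [h0, Nat.cast_zero, mul_zero]
    exact value_nonneg hv (hn.trans hb) β
  have hle : alloc K b' β ≤ alloc K b β := alloc_mono hn hbid
  have hM := (alloc_spec K b β).1
  have hw := mul_sum_le_mul_sum hv hle (by omega)
  have hp := price_mono hn hbid hpos
  have hr : (0 : ℝ) < alloc K b β := by exact_mod_cast hpos.trans_le hle
  have hr' : (0 : ℝ) < alloc K b' β := by exact_mod_cast hpos
  unfold value at *
  refine le_of_mul_le_mul_left ?_ hr
  calc (alloc K b β : ℝ) * (price K b' β * alloc K b' β)
      ≤ (alloc K b β : ℝ) * (price K b β * alloc K b' β) := by gcongr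
    _ = (alloc K b' β : ℝ) * (price K b β * alloc K b β) := by ring
    _ ≤ (alloc K b' β : ℝ) * ∑ j ∈ Finset.Icc 1 (alloc K b β), v j := by gcongr
    _ ≤ _ := hw

end Valuation

namespace Uniform

theorem Q_mono_s16 (s : Uniform) : Monotone s.Q := fun _ _ h =>
  Finset.sum_le_sum_of_subset (Finset.Icc_subset_Icc_right h)

theorem Q_zero (s : Uniform) : s.Q 0 = 0 := by simp [Q]

theorem Q_succ_s16 (s : Uniform) (j : ℕ) : s.Q (j + 1) = s.Q j + s.q (j + 1) :=
  Finset.sum_Icc_succ_top (by omega) _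

theorem bid_eq (s : Uniform) {ℓ i : ℕ} (h1 : s.Q ℓ < i) (h2 : i ≤ s.Q (ℓ + 1)) :
    s.toBidVec.bid i = s.b (ℓ + 1) := by
  have : sInf {k : ℕ | i ≤ s.Q k} = ℓ + 1 := by
    refine le_antisymm (Nat.sInf_le h2) (le_csInf ⟨_, h2⟩ fun k hk => ?_)
    by_contra hlt
    have := s.Q_mono_s16 (show k ≤ ℓ by omega)
    have hk' : i ≤ s.Q k := hk
    omega
  simp only [toBidVec, this]

theorem exists_block (s : Uniform) {i : ℕ} (h1 : 1 ≤ i) (h2 : i ≤ s.Q s.m) :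
    ∃ ℓ, ℓ + 1 ≤ s.m ∧ s.Q ℓ < i ∧ i ≤ s.Q (ℓ + 1) := by
  classical
  have hex : ∃ k, i ≤ s.Q k := ⟨_, h2⟩
  obtain ⟨ℓ, hℓ⟩ : ∃ ℓ, Nat.find hex = ℓ + 1 := Nat.exists_eq_succ_of_ne_zero fun h0 => by
    have := Nat.find_spec hex
    rw [h0, Q_zero] at this
    omega
  refine ⟨ℓ, hℓ ▸ Nat.find_min' hex h2, ?_, hℓ ▸ Nat.find_spec hex⟩
  have := Nat.find_min hex (m := ℓ) (by omega)
  omega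

theorem IsUniform.b_anti {M : ℕ} {s : Uniform} (hs : s.IsUniform M) {i j : ℕ} (hi : 1 ≤ i)
    (hij : i ≤ j) (hj : j ≤ s.m) : s.b j ≤ s.b i := by
  induction j, hij using Nat.le_induction with
  | base => exact le_rfl
  | succ n hn ih => exact (hs.2.2.2.1 n (by omega) (by omega)).le.trans (ih (by omega))

theorem IsUniform.bid_anti {M : ℕ} {s : Uniform} (hs : s.IsUniform M) (i j : ℕ) (hi : 1 ≤ i)
    (hij : i ≤ j) (hj : j ≤ s.toBidVec.n) : s.toBidVec.bid j ≤ s.toBidVec.bid i := by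
  obtain ⟨k, hk, hk1, hk2⟩ := s.exists_block hi (hij.trans hj)
  obtain ⟨l, hl, hl1, hl2⟩ := s.exists_block (hi.trans hij) hj
  rw [s.bid_eq hk1 hk2, s.bid_eq hl1 hl2]
  refine hs.b_anti (by omega) ?_ hl
  by_contra hlt
  have := s.Q_mono_s16 (show l + 1 ≤ k by omega)
  omega

/-- Delete the `k`-th bid value, moving its quantity to the next lower bid (and dropping
the quantity if there is none). -/
def delete (s : Uniform) (k : ℕ) : Uniform where
  m := s.m - 1
  b j := if j < k then s.b j else s.b (j + 1)
  q j := if j < k then s.q j else if j = k then s.q k + s.q (k + 1) else s.q (j + 1)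

theorem delete_Q (s : Uniform) {k : ℕ} (hk : 1 ≤ k) (j : ℕ) :
    (s.delete k).Q j = if j < k then s.Q j else s.Q (j + 1) := by
  induction j with
  | zero => rw [Q_zero, Q_zero, if_pos (by omega)]
  | succ j ih =>
    rw [Q_succ_s16, ih]
    simp only [delete]
    rcases lt_trichotomy (j + 1) k with h | h | h
    · rw [if_pos (by omega), if_pos h, if_pos h, Q_succ_s16]
    · subst h
      simp only [lt_irrefl, if_true, if_false, Nat.lt_succ_self, Q_succ_s16]
      omega
    · rw [if_neg (by omega), if_neg (by omega), if_neg (by omega), if_neg (by omega),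
        s.Q_succ_s16 (j + 1)]

variable {M : ℕ} {s : Uniform} {k : ℕ}

theorem delete_n_le (s : Uniform) (hm : 1 ≤ s.m) (hk : 1 ≤ k) :
    (s.delete k).toBidVec.n ≤ s.toBidVec.n := by
  change (s.delete k).Q (s.m - 1) ≤ s.Q s.m
  rw [delete_Q s hk]
  split_ifs
  · exact s.Q_mono_s16 (by omega)
  · exact s.Q_mono_s16 (by omega)

theorem IsUniform.delete (hs : s.IsUniform M) (hm : 2 ≤ s.m) (hk : 1 ≤ k) (hkm : k ≤ s.m) :
    (s.delete k).IsUniform M := by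
  have hn := s.delete_n_le (by omega) hk
  obtain ⟨-, hq, hpos, hdec, hM⟩ := hs
  refine ⟨show 1 ≤ s.m - 1 by omega, fun j hj hjm => ?_, ?_, fun j hj hjm => ?_, hn.trans hM⟩
  · change j ≤ s.m - 1 at hjm
    have h1 := hq j hj (by omega)
    have h2 := hq (j + 1) (by omega) (by omega)
    simp only [Uniform.delete]
    split_ifs with h h'
    · exact h1
    · subst h'; omega
    · exact h2
  · simp only [Uniform.delete]
    have h := hdec (s.m - 1) (by omega) (by omega)
    rw [Nat.sub_add_cancel (by omega)] at h ⊢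
    split_ifs
    · exact hpos.trans h
    · exact hpos
  · change j < s.m - 1 at hjm
    have h1 := hdec j hj (by omega)
    have h2 := hdec (j + 1) (by omega) (by omega)
    simp only [Uniform.delete]
    split_ifs
    · exact h1
    · omega
    · exact h2.trans h1
    · exact h2

/-- Deleting a bid value keeps the bids on the units of all other blocks. -/
theorem delete_bid_of_ne (s : Uniform) {ℓ i : ℕ} (hk : 1 ≤ k) (hne : ℓ + 1 ≠ k)
    (h1 : s.Q ℓ < i) (h2 : i ≤ s.Q (ℓ + 1)) :
    (s.delete k).toBidVec.bid i = s.toBidVec.bid i := by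
  rw [s.bid_eq h1 h2]
  rcases lt_or_gt_of_ne hne with h | h
  · rw [(s.delete k).bid_eq (ℓ := ℓ)]
    · simp only [delete, if_pos h]
    · rwa [delete_Q s hk, if_pos (by omega)]
    · rwa [delete_Q s hk, if_pos h]
  · obtain ⟨p, rfl⟩ : ∃ p, ℓ = p + 1 := Nat.exists_eq_succ_of_ne_zero (by omega)
    rw [(s.delete k).bid_eq (ℓ := p)]
    · simp only [delete, if_neg (show ¬ p + 1 < k by omega)]
    · rw [delete_Q s hk]
      split_ifs
      · exact (s.Q_mono_s16 (Nat.le_succ p)).trans_lt h1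
      · exact h1
    · rwa [delete_Q s hk, if_neg (by omega)]

theorem delete_n_ge (s : Uniform) {ℓ : ℕ} (hk : 1 ≤ k) (hne : ℓ + 1 ≠ k)
    (hkm : k ≤ s.m) (hℓ : ℓ + 1 ≤ s.m) : s.Q (ℓ + 1) ≤ (s.delete k).toBidVec.n := by
  change _ ≤ (s.delete k).Q (s.m - 1)
  rw [delete_Q s hk]
  split_ifs
  · exact s.Q_mono_s16 (by omega)
  · exact s.Q_mono_s16 (by omega)

theorem IsUniform.delete_bid_le (hs : s.IsUniform M) (hk : 1 ≤ k) (hkm : k ≤ s.m) (i : ℕ)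
    (hi : 1 ≤ i) (hin : i ≤ (s.delete k).toBidVec.n) :
    (s.delete k).toBidVec.bid i ≤ s.toBidVec.bid i := by
  have hn := s.delete_n_le hs.1 hk
  obtain ⟨ℓ, hℓ, h1, h2⟩ := s.exists_block hi (hin.trans hn)
  by_cases hne : ℓ + 1 = k
  · subst hne
    have hlt : ℓ + 1 < s.m := by
      by_contra hge
      have : (s.delete (ℓ + 1)).toBidVec.n = s.Q ℓ := by
        change (s.delete (ℓ + 1)).Q (s.m - 1) = _
        rw [delete_Q s hk, if_pos (by omega), show s.m - 1 = ℓ by omega]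
      omega
    rw [s.bid_eq h1 h2, (s.delete (ℓ + 1)).bid_eq (ℓ := ℓ)]
    · simp only [Uniform.delete, lt_irrefl, if_false]
      exact (hs.2.2.2.1 _ hk hlt).le
    · rwa [delete_Q s hk, if_pos (by omega)]
    · rw [delete_Q s hk, if_neg (by omega)]
      exact h2.trans (s.Q_mono_s16 (by omega))
  · exact (s.delete_bid_of_ne hk hne h1 h2).le

theorem IsUniform.value_delete (hs : s.IsUniform M) (hm : 2 ≤ s.m) {v : ℕ → ℝ} {K : ℕ}
    (β : Profile K) {ℓ : ℕ} (hℓ : ℓ + 1 ≤ s.m) (h1 : s.Q ℓ < alloc K s.toBidVec β)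
    (h2 : alloc K s.toBidVec β ≤ s.Q (ℓ + 1)) (hk : 1 ≤ k) (hkm : k ≤ s.m) (hne : ℓ + 1 ≠ k) :
    value v K (s.delete k).toBidVec β = value v K s.toBidVec β := by
  have : alloc K (s.delete k).toBidVec β = alloc K s.toBidVec β :=
    le_antisymm (alloc_mono (s.delete_n_le hs.1 hk) (hs.delete_bid_le hk hkm))
      (alloc_le_of_bid_eq (hs.delete hm hk hkm).bid_anti
        (h2.trans (s.delete_n_ge hk hne hkm hℓ)) (s.delete_bid_of_ne hk hne h1 h2))
  simp only [value, this]

theorem IsUniform.sum_value_delete (hs : s.IsUniform M) (hm : 2 ≤ s.m) {v : ℕ → ℝ}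
    (hv : ValidValuation M v) {K : ℕ} (β : Profile K) :
    ((s.m : ℝ) - 1) * value v K s.toBidVec β ≤
      ∑ k ∈ Finset.Icc 1 s.m, value v K (s.delete k).toBidVec β := by
  have hnn : ∀ k ∈ Finset.Icc 1 s.m, 0 ≤ value v K (s.delete k).toBidVec β := fun k hk => by
    rw [Finset.mem_Icc] at hk
    exact value_nonneg hv ((s.delete_n_le hs.1 hk.1).trans hs.2.2.2.2) β
  rcases Nat.eq_zero_or_pos (alloc K s.toBidVec β) with h0 | hpos
  · have : value v K s.toBidVec β = 0 := by simp [value, h0]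
    rw [this, mul_zero]
    exact Finset.sum_nonneg hnn
  · obtain ⟨ℓ, hℓ, h1, h2⟩ := s.exists_block hpos
      ((alloc_spec K s.toBidVec β).1.trans (min_le_left _ _))
    have hmem : ℓ + 1 ∈ Finset.Icc 1 s.m := Finset.mem_Icc.2 ⟨by omega, hℓ⟩
    rw [← Finset.add_sum_erase _ _ hmem]
    have hsum : ∑ k ∈ (Finset.Icc 1 s.m).erase (ℓ + 1), value v K (s.delete k).toBidVec β =
        ((s.m : ℝ) - 1) * value v K s.toBidVec β := by
      rw [Finset.sum_congr rfl (g := fun _ => value v K s.toBidVec β) fun k hk => ?_]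
      · rw [Finset.sum_const, Finset.card_erase_of_mem hmem, Nat.card_Icc, nsmul_eq_mul,
          Nat.add_sub_cancel, Nat.cast_sub hs.1, Nat.cast_one]
      · rw [Finset.mem_erase, Finset.mem_Icc] at hk
        exact hs.value_delete hm β hℓ h1 h2 hk.2.1 hk.2.2 hk.1.symm
    rw [hsum]
    linarith [hnn _ hmem]

end Uniform

section FeasClass

variable {M K T m : ℕ} {v : ℕ → ℝ} {H : ℕ → Profile K} {s : Uniform}

theorem totalValue_nonneg (hv : ValidValuation M v) (hs : s.IsUniform M) :
    0 ≤ totalValue v K T H s :=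
  Finset.sum_nonneg fun t _ => value_nonneg hv hs.2.2.2.2 (H t)

theorem bddAbove_totalValue (hv : ValidValuation M v) :
    BddAbove {x : ℝ | ∃ s : Uniform, InFeasClass M v K T H m s ∧ x = totalValue v K T H s} := by
  refine ⟨∑ _t ∈ Finset.Icc 1 T, ∑ j ∈ Finset.Icc 1 M, v j, ?_⟩
  rintro x ⟨s, hs, rfl⟩
  exact Finset.sum_le_sum fun t _ => value_le_sum hv hs.1.2.2.2.2 (H t)

theorem totalValue_le_bestFeas (hv : ValidValuation M v) (hs : InFeasClass M v K T H m s) :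
    totalValue v K T H s ≤ bestFeas M v K T H m :=
  le_csSup (bddAbove_totalValue hv) ⟨s, hs, rfl⟩

theorem bestFeas_nonneg (hv : ValidValuation M v) : 0 ≤ bestFeas M v K T H m := by
  refine Real.sSup_nonneg ?_
  rintro x ⟨s, hs, rfl⟩
  exact totalValue_nonneg hv hs.1

/-- Some bid value can be deleted at the loss of at most an average share of the value. -/
theorem InFeasClass.exists_delete (hv : ValidValuation M v) (hs : InFeasClass M v K T H (m + 1) s)
    (hsm : s.m = m + 1) (hm : 1 ≤ m) : ∃ s', InFeasClass M v K T H m s' ∧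
      (m : ℝ) * totalValue v K T H s ≤ ((m : ℝ) + 1) * totalValue v K T H s' := by
  obtain ⟨hu, -, hf⟩ := hs
  have hsum : ∑ _k ∈ Finset.Icc 1 s.m, (m : ℝ) * totalValue v K T H s ≤
      ∑ k ∈ Finset.Icc 1 s.m, ((m : ℝ) + 1) * totalValue v K T H (s.delete k) := by
    have h : ∑ t ∈ Finset.Icc 1 T, ((s.m : ℝ) - 1) * value v K s.toBidVec (H t) ≤
        ∑ t ∈ Finset.Icc 1 T, ∑ k ∈ Finset.Icc 1 s.m, value v K (s.delete k).toBidVec (H t) :=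
      Finset.sum_le_sum fun t _ => hu.sum_value_delete (by omega) hv (H t)
    rw [Finset.sum_comm, ← Finset.mul_sum] at h
    rw [Finset.sum_const, Nat.card_Icc, Nat.add_sub_cancel, nsmul_eq_mul, ← Finset.mul_sum]
    rw [hsm] at h ⊢
    push_cast at h ⊢
    rw [add_sub_cancel_right] at h
    exact mul_le_mul_of_nonneg_left h (by positivity)
  obtain ⟨k, hk, hle⟩ := Finset.exists_le_of_sum_le ⟨1, Finset.mem_Icc.2 ⟨le_rfl, hu.1⟩⟩ hsum
  rw [Finset.mem_Icc] at hk
  refine ⟨s.delete k, ⟨hu.delete (by omega) hk.1 hk.2, ?_, fun t ht => ?_⟩, hle⟩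
  · change s.m - 1 ≤ m
    omega
  · exact (hf t ht).of_le hv hu.2.2.2.2 (s.delete_n_le hu.1 hk.1) (hu.delete_bid_le hk.1 hk.2)

theorem bestFeas_succ_le (hv : ValidValuation M v) (hm : 1 ≤ m) :
    (m : ℝ) * bestFeas M v K T H (m + 1) ≤ ((m : ℝ) + 1) * bestFeas M v K T H m := by
  have hm0 : (0 : ℝ) < m := by exact_mod_cast hm
  have hB : 0 ≤ bestFeas M v K T H m := bestFeas_nonneg hv
  rw [← le_div_iff₀' hm0]
  refine Real.sSup_le ?_ (by positivity)
  rintro x ⟨s, hs, rfl⟩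
  rw [le_div_iff₀' hm0]
  rcases hs.2.1.eq_or_lt with hsm | hsm
  · obtain ⟨s', hs', hle⟩ := hs.exists_delete hv hsm hm
    exact hle.trans (mul_le_mul_of_nonneg_left (totalValue_le_bestFeas hv hs') (by positivity))
  · have hle := totalValue_le_bestFeas hv (m := m) ⟨hs.1, Nat.lt_succ_iff.1 hsm, hs.2.2⟩
    nlinarith

end FeasClass

/-- Theorem `thm:m-mbar-strong`: for `m ≤ m'`, every bid history and
every valuation vector, the optimal value over RoI-feasible strategies with at most
`m'` bid-quantity pairs is at most `m'/m` times that over RoI-feasible strategies with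
at most `m` bid-quantity pairs. -/
theorem richness_feasible_classes (m m' : ℕ) (hm : 1 ≤ m) (hmm' : m ≤ m')
    (K M T : ℕ) (v : ℕ → ℝ) (hv : ValidValuation M v) (hMK : M ≤ K)
    (H : ℕ → Profile K) :
    bestFeas M v K T H m' ≤ ((m' : ℝ) / (m : ℝ)) * bestFeas M v K T H m := by
  have hm0 : (0 : ℝ) < m := by exact_mod_cast hm
  rw [div_mul_eq_mul_div, le_div_iff₀' hm0]
  induction m', hmm' using Nat.le_induction with
  | base => exact le_rfl
  | succ n hn ih =>
    have hn0 : (0 : ℝ) < n := hm0.trans_le (by exact_mod_cast hn)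
    have h := bestFeas_succ_le (K := K) (T := T) (H := H) hv (hm.trans hn)
    refine le_of_mul_le_mul_left ?_ hn0
    push_cast
    nlinarith [mul_le_mul_of_nonneg_left h hm0.le,
      mul_le_mul_of_nonneg_left ih (show (0 : ℝ) ≤ n + 1 by positivity)]

end Auction
end

section
/- Regret lower bound: there is a universal constant c > 0 (one may take c = 1/(36·√e)) such that for every even integer M ≥ 2 and every T ≥ 1 the following holds. Set K = M and m = 1; there exist a valuation vector v = (v_1,…,v_M) with entries in [0,1] (specifically v_j = 1 for j ≤ M/2 and v_j = 1 − δ for j > M/2 with δ = 1/(4√(2T))) and a probability distribution 𝒟 over bid histories (β₋^1,…,β₋^T) — namely, independent draws each round from a two-point distribution over two fixed competing-bid profiles — such that for every (possibly randomized) full-information learning algorithm, i.e., every sequence of maps from (β₋^1,…,β₋^{t−1}) to probability distributions over 𝒫*_1 determining the played strategy b^t, the expected regret satisfies E[ max_{b ∈ 𝒫*_1} ∑_{t=1}^{T} V(b;β₋^t) − ∑_{t=1}^{T} V(b^t;β₋^t) ] ≥ c·M·√T, where the expectation is over 𝒟 and the algorithm's randomness. -/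
open Finset

namespace Auction

/-! ### Independent biased coins -/

/-- Summing over all outcomes of independent coins by conditioning on the `i`-th coin. -/
lemma sum_prod_mul_insertNth {n : ℕ} (W : Bool → ℝ) (i : Fin (n + 1))
    (f : (Fin (n + 1) → Bool) → ℝ) :
    ∑ ω : Fin (n + 1) → Bool, (∏ j, W (ω j)) * f ω =
      ∑ ω : Fin n → Bool, (∏ j, W (ω j)) *
        (W true * f (i.insertNth true ω) + W false * f (i.insertNth false ω)) := by
  rw [← (Fin.insertNthEquiv (fun _ => Bool) i).sum_comp, Fintype.sum_prod_type,
    Fintype.sum_bool, ← Finset.sum_add_distrib]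
  refine Finset.sum_congr rfl fun ω _ => ?_
  simp only [Fin.insertNthEquiv, Equiv.coe_fn_mk, Fin.prod_univ_succAbove _ i,
    Fin.insertNth_apply_same, Fin.insertNth_apply_succAbove]
  ring

/-- A function of a random walk has the expectation obtained by solving the corresponding
backward recursion. -/
lemma sum_prod_mul_walk (W Y : Bool → ℝ) (F : ℕ → ℝ → ℝ)
    (hF : ∀ n x, F (n + 1) x = W true * F n (x + Y true) + W false * F n (x + Y false))
    (n : ℕ) (x : ℝ) :
    ∑ ω : Fin n → Bool, (∏ j, W (ω j)) * F 0 (x + ∑ j, Y (ω j)) = F n x := by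
  induction n generalizing x with
  | zero => simp
  | succ n ih =>
    rw [sum_prod_mul_insertNth W 0 fun ω => F 0 (x + ∑ j, Y (ω j)), hF, ← ih, ← ih,
      Finset.mul_sum, Finset.mul_sum, ← Finset.sum_add_distrib]
    refine Finset.sum_congr rfl fun ω _ => ?_
    simp only [Fin.sum_univ_succAbove _ (0 : Fin (n + 1)), Fin.insertNth_apply_same,
      Fin.insertNth_apply_succAbove, add_assoc]
    ring

lemma sum_prod_coin (W : Bool → ℝ) (hW : W true + W false = 1) (n : ℕ) :
    ∑ ω : Fin n → Bool, ∏ j, W (ω j) = 1 := by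
  simpa using sum_prod_mul_walk W (fun _ => 0) (fun _ _ => 1) (fun _ _ => by simp [hW]) n 0

/-- A quartic polynomial lower bound for the positive part. -/
lemma le_max_zero_of_pos {l : ℝ} (hl : 0 < l) (x : ℝ) :
    x / 2 + (3 * x ^ 2 / l - x ^ 4 / l ^ 3) / 4 ≤ max 0 x := by
  have key (u : ℝ) (hu : 0 ≤ u) : (3 * u ^ 2 - u ^ 4) / 4 ≤ u / 2 := by
    nlinarith [mul_nonneg (mul_nonneg hu (by linarith : 0 ≤ u + 2)) (sq_nonneg (u - 1))]
  have h := mul_le_mul_of_nonneg_left (key (|x| / l) (by positivity)) hl.le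
  have h₁ : l * ((3 * (|x| / l) ^ 2 - (|x| / l) ^ 4) / 4) =
      (3 * x ^ 2 / l - x ^ 4 / l ^ 3) / 4 := by
    have h₄ : |x| ^ 4 = x ^ 4 := Even.pow_abs (by decide) x
    rw [div_pow, div_pow, sq_abs, h₄]
    field_simp
  have h₂ : l * (|x| / l / 2) = |x| / 2 := by field_simp
  rw [h₁, h₂] at h
  rcases le_total 0 x with hx | hx
  · rw [abs_of_nonneg hx] at h
    rw [max_eq_right hx]
    linarith
  · rw [abs_of_nonpos hx] at h
    rw [max_eq_left hx]
    linarith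

/-- The probabilities of the two outcomes of a coin with heads probability `2 / 3`. -/
noncomputable def coin (b : Bool) : ℝ := if b then 2 / 3 else 1 - 2 / 3

/-- The steps of a centered random walk driven by `coin`. -/
noncomputable def step (b : Bool) : ℝ := if b then 1 else -2

lemma coin_nonneg (b : Bool) : 0 ≤ coin b := by cases b <;> norm_num [coin]

lemma coin_add : coin true + coin false = 1 := by norm_num [coin]

/-- Khinchin-type lower bound for the positive part of the walk driven by `step`. -/
lemma sqrt_le_sum_prod_coin_mul_max {T : ℕ} (hT : 1 ≤ T) :
    3 / 8 * √T ≤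
      ∑ ω : Fin T → Bool, (∏ j, coin (ω j)) * max 0 (∑ j, step (ω j)) := by
  have hT' : (0 : ℝ) < T := by exact_mod_cast hT
  have hr : 0 < √(T : ℝ) := Real.sqrt_pos.2 hT'
  have hsq : √(T : ℝ) ^ 2 = T := Real.sq_sqrt hT'.le
  set r := √(T : ℝ)
  have hl : 0 < 2 * r := by positivity
  have hwalk := sum_prod_mul_walk coin step
    (fun n x => x / 2 + (3 * (x ^ 2 + 2 * n) / (2 * r) -
      (x ^ 4 + 12 * n * x ^ 2 - 8 * n * x + 12 * n ^ 2 - 6 * n) / (2 * r) ^ 3) / 4)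
    (fun n x => by simp [coin, step]; ring) T 0
  calc 3 / 8 * r ≤ 3 / 8 * r + 6 * T / (2 * r) ^ 3 / 4 := by
        have : 0 ≤ 6 * T / (2 * r) ^ 3 / 4 := by positivity
        linarith
    _ = _ := by
        rw [← hsq]
        field_simp
        ring
    _ = _ := hwalk.symm
    _ ≤ _ := by
        refine Finset.sum_le_sum fun ω _ => mul_le_mul_of_nonneg_left ?_
          (Finset.prod_nonneg fun j _ => coin_nonneg _)
        simpa using le_max_zero_of_pos hl (∑ j, step (ω j))

/-! ### The auction instance -/

/-- The profile in which all competing bids equal `a`. -/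
def constProfile (K : ℕ) (a : ℝ) (ha : 0 ≤ a) : Profile K :=
  ⟨fun _ => a, fun _ _ _ _ _ => le_rfl, fun _ _ _ => ha⟩

lemma value_single_constProfile_of_le (v : ℕ → ℝ) {K q : ℕ} {a b : ℝ} (ha : 0 ≤ a)
    (hq : 1 ≤ q) (hqK : q ≤ K) (hab : a ≤ b) :
    value v K (single b q).toBidVec (constProfile K a ha) = ∑ j ∈ Icc 1 q, v j := by
  have : alloc K (single b q).toBidVec (constProfile K a ha) = q := by
    have hn : (single b q).toBidVec.n = q := by simp [single, Uniform.toBidVec, Uniform.Q]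
    simp only [alloc, hn, min_eq_left hqK]
    refine le_antisymm (Finset.sup_le fun r hr => ?_) (Finset.le_sup (f := id) ?_)
    · simp only [mem_filter] at hr
      exact (mem_Icc.1 hr.1).2
    · simp only [mem_filter]
      exact ⟨mem_Icc.2 ⟨hq, le_rfl⟩, fun _ _ => hab⟩
  rw [value, this]

lemma value_single_constProfile_of_lt (v : ℕ → ℝ) {K q : ℕ} {a b : ℝ} (ha : 0 ≤ a)
    (hab : b < a) :
    value v K (single b q).toBidVec (constProfile K a ha) = 0 := by
  have : alloc K (single b q).toBidVec (constProfile K a ha) = 0 := by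
    refine Nat.le_zero.1 (Finset.sup_le fun r hr => ?_)
    simp only [mem_filter] at hr
    exact absurd hab (hr.2 1 (mem_Icc.2 ⟨le_rfl, (mem_Icc.1 hr.1).1⟩)).not_gt
  rw [value, this]
  simp

/-- Valuation `1` on the first `N` units and `1 / 2` on all further ones. -/
noncomputable def stepVal (N : ℕ) (j : ℕ) : ℝ := if j ≤ N then 1 else 1 / 2

lemma stepVal_nonneg (N j : ℕ) : 0 ≤ stepVal N j := by
  unfold stepVal; split_ifs <;> norm_num

lemma stepVal_le_one (N j : ℕ) : stepVal N j ≤ 1 := by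
  unfold stepVal; split_ifs <;> norm_num

lemma stepVal_antitone (N : ℕ) : Antitone (stepVal N) := by
  intro i j hij
  unfold stepVal
  split_ifs <;> first | omega | norm_num

lemma sum_stepVal_of_le {N q : ℕ} (h : q ≤ N) : ∑ j ∈ Icc 1 q, stepVal N j = q := by
  rw [Finset.sum_congr rfl fun j hj =>
    show stepVal N j = 1 from if_pos ((mem_Icc.1 hj).2.trans h)]
  simp

lemma sum_stepVal_add (N k : ℕ) :
    ∑ j ∈ Icc 1 (N + k), stepVal N j = N + k / 2 := by
  induction k with
  | zero => simpa using sum_stepVal_of_le (le_refl N)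
  | succ k ih =>
    rw [← add_assoc, Finset.sum_Icc_succ_top (by omega), ih, stepVal, if_neg (by omega)]
    push_cast
    ring

lemma w_stepVal_nonneg (N q : ℕ) : 0 ≤ w (stepVal N) q :=
  div_nonneg (Finset.sum_nonneg fun j _ => stepVal_nonneg N j) q.cast_nonneg

lemma w_stepVal_of_le {N q : ℕ} (hq : 1 ≤ q) (h : q ≤ N) : w (stepVal N) q = 1 := by
  rw [w, sum_stepVal_of_le h, div_self]
  exact_mod_cast (by omega : q ≠ 0)

lemma w_stepVal_lt_one {N q : ℕ} (h : N < q) : w (stepVal N) q < 1 := by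
  obtain ⟨k, rfl⟩ := Nat.exists_eq_add_of_lt h
  rw [w, add_assoc, sum_stepVal_add, div_lt_one (by positivity)]
  push_cast
  linarith [k.cast_nonneg (α := ℝ)]

/-- The competing profile selected by a coin: free units on heads, price `1` on tails. -/
noncomputable def coinProfile (K : ℕ) (b : Bool) : Profile K :=
  if b then constProfile K 0 le_rfl else constProfile K 1 zero_le_one

lemma value_coinProfile_half {N : ℕ} (hN : 1 ≤ N) (b : Bool) :
    value (stepVal N) (N + N) (single (w (stepVal N) N) N).toBidVec
      (coinProfile (N + N) b) = N := by
  have hw := w_stepVal_of_le hN le_rfl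
  cases b
  · rw [coinProfile, if_neg (by simp), value_single_constProfile_of_le _ _ hN (by omega) hw.ge,
      sum_stepVal_of_le le_rfl]
  · rw [coinProfile, if_pos rfl, value_single_constProfile_of_le _ _ hN (by omega)
      (w_stepVal_nonneg _ _), sum_stepVal_of_le le_rfl]

lemma value_coinProfile_full {N : ℕ} (hN : 1 ≤ N) (b : Bool) :
    value (stepVal N) (N + N) (single (w (stepVal N) (N + N)) (N + N)).toBidVec
      (coinProfile (N + N) b) = N + N / 2 * step b := by
  cases b
  · rw [coinProfile, if_neg (by simp), value_single_constProfile_of_lt _ _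
      (w_stepVal_lt_one (by omega))]
    norm_num [step]
  · rw [coinProfile, if_pos rfl, value_single_constProfile_of_le _ _ (by omega) le_rfl
      (w_stepVal_nonneg _ _), sum_stepVal_add]
    simp [step]

lemma coin_value_coinProfile_le {N q : ℕ} (hq : 1 ≤ q) (hqM : q ≤ N + N) :
    coin true * value (stepVal N) (N + N) (single (w (stepVal N) q) q).toBidVec
        (coinProfile (N + N) true) +
      coin false * value (stepVal N) (N + N) (single (w (stepVal N) q) q).toBidVec
        (coinProfile (N + N) false) ≤ N := by
  simp only [coinProfile, if_true, Bool.false_eq_true, if_false, coin]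
  rw [value_single_constProfile_of_le _ _ hq hqM (w_stepVal_nonneg _ _)]
  rcases le_or_gt q N with h | h
  · rw [value_single_constProfile_of_le _ _ hq hqM (w_stepVal_of_le hq h).ge, sum_stepVal_of_le h]
    have : (q : ℝ) ≤ N := by exact_mod_cast h
    linarith
  · rw [value_single_constProfile_of_lt _ _ (w_stepVal_lt_one h)]
    obtain ⟨k, rfl⟩ := Nat.exists_eq_add_of_le h.le
    rw [sum_stepVal_add]
    have : (k : ℝ) ≤ N := by exact_mod_cast (by omega : k ≤ N)
    linarith

/-- If every action has expected gain at most `B` against a fresh coin, so does a randomized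
action that is independent of that coin. -/
lemma sum_prod_mul_mix_le {T : ℕ} {ι : Type*} (s : Finset ι) {W : Bool → ℝ}
    (hW₀ : ∀ b, 0 ≤ W b) (hW₁ : W true + W false = 1) (i : Fin T)
    (a : (Fin T → Bool) → ι → ℝ) (ha₀ : ∀ ω q, 0 ≤ a ω q) (ha₁ : ∀ ω, ∑ q ∈ s, a ω q = 1)
    (ha : ∀ ω ω', (∀ j, j ≠ i → ω j = ω' j) → a ω = a ω') (g : ι → Bool → ℝ) {B : ℝ}
    (hg : ∀ q ∈ s, W true * g q true + W false * g q false ≤ B) :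
    ∑ ω : Fin T → Bool, (∏ j, W (ω j)) * ∑ q ∈ s, a ω q * g q (ω i) ≤ B := by
  obtain _ | n := T
  · exact i.elim0
  rw [sum_prod_mul_insertNth W i fun ω => ∑ q ∈ s, a ω q * g q (ω i)]
  calc _ ≤ ∑ ω : Fin n → Bool, (∏ j, W (ω j)) * B := by
        refine Finset.sum_le_sum fun ω _ => mul_le_mul_of_nonneg_left ?_
          (Finset.prod_nonneg fun j _ => hW₀ _)
        have hcongr : a (i.insertNth false ω) = a (i.insertNth true ω) := by
          refine ha _ _ fun j hj => ?_
          obtain ⟨k, rfl⟩ := Fin.exists_succAbove_eq hj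
          simp
        simp only [hcongr, Fin.insertNth_apply_same]
        calc _ = ∑ q ∈ s, a (i.insertNth true ω) q *
              (W true * g q true + W false * g q false) := by
              rw [Finset.mul_sum, Finset.mul_sum, ← Finset.sum_add_distrib]
              exact Finset.sum_congr rfl fun q _ => by ring
          _ ≤ ∑ q ∈ s, a (i.insertNth true ω) q * B :=
              Finset.sum_le_sum fun q hq => mul_le_mul_of_nonneg_left (hg q hq) (ha₀ _ _)
          _ = B := by rw [← Finset.sum_mul, ha₁, one_mul]
    _ = B := by rw [← Finset.sum_mul, sum_prod_coin W hW₁, one_mul]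

lemma sum_Icc_one_eq_sum_fin (T : ℕ) (f : ℕ → ℝ) :
    ∑ t ∈ Icc 1 T, f t = ∑ i : Fin T, f ((i : ℕ) + 1) := by
  rw [Fin.sum_univ_eq_sum_range fun i => f (i + 1), Finset.range_eq_Ico,
    Finset.sum_Ico_add' f 0 T 1]
  rfl

/-- Theorem `thm:regret-LB`: there is a universal constant `c > 0`
such that for every even `M ≥ 2` and every `T ≥ 1` (with `K = M`, `m = 1`) there exist
a valuation vector `v` with entries in `[0,1]`, two competing-bid profiles and a
two-point distribution (i.i.d. across rounds, represented by i.i.d. Boolean coins with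
parameter `p`) such that every (possibly randomized) full-information learning
algorithm — a prefix-measurable rule mapping past observations to a probability
distribution over the 1-uniform safe strategies `(w q, q)`, `q ∈ {1,…,M}` — incurs
expected regret at least `c·M·√T`. -/
theorem regret_lower_bound :
    ∃ c : ℝ, 0 < c ∧
      ∀ M T : ℕ, ∀ (hM : 2 ≤ M) (_ : Even M) (_ : 1 ≤ T),
        ∃ (v : ℕ → ℝ) (β1 β2 : Profile M) (p : ℝ),
          ValidValuation M v ∧ (∀ j : ℕ, 1 ≤ j → j ≤ M → v j ≤ 1) ∧
          0 ≤ p ∧ p ≤ 1 ∧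
          ∀ Hist : (Fin T → Bool) → ℕ → Profile M,
            (∀ (ω : Fin T → Bool) (i : Fin T),
              Hist ω ((i : ℕ) + 1) = if ω i then β1 else β2) →
            ∀ A : ℕ → (Fin T → Bool) → ℕ → ℝ,
              (∀ (t : ℕ) (ω : Fin T → Bool) (q : ℕ), 0 ≤ A t ω q) →
              (∀ (t : ℕ) (ω : Fin T → Bool), ∑ q ∈ Finset.Icc 1 M, A t ω q = 1) →
              (∀ (t : ℕ) (ω ω' : Fin T → Bool),
                (∀ i : Fin T, (i : ℕ) < t - 1 → ω i = ω' i) → A t ω = A t ω') →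
              c * (M : ℝ) * Real.sqrt T ≤
                ∑ ω : Fin T → Bool,
                  (∏ i : Fin T, if ω i then p else 1 - p) *
                    ((Finset.Icc 1 M).sup' (Finset.nonempty_Icc.mpr (le_trans one_le_two hM))
                        (fun q => ∑ t ∈ Finset.Icc 1 T,
                          value v M (single (w v q) q).toBidVec (Hist ω t)) -
                      ∑ t ∈ Finset.Icc 1 T, ∑ q ∈ Finset.Icc 1 M,
                        A t ω q * value v M (single (w v q) q).toBidVec (Hist ω t)) := by
  refine ⟨3 / 32, by norm_num, ?_⟩
  rintro M T hM ⟨N, rfl⟩ hT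
  have hN : 1 ≤ N := by omega
  refine ⟨stepVal N, coinProfile (N + N) true, coinProfile (N + N) false, 2 / 3,
    ⟨fun j _ _ => stepVal_nonneg N j, fun i j _ hij _ => stepVal_antitone N hij⟩,
    fun j _ _ => stepVal_le_one N j, by norm_num, by norm_num, ?_⟩
  intro Hist hHist A hA₀ hA₁ hA
  have hH (ω : Fin T → Bool) (i : Fin T) :
      Hist ω ((i : ℕ) + 1) = coinProfile (N + N) (ω i) := by
    rw [hHist]; cases ω i <;> simp
  have hW (ω : Fin T → Bool) :
      (∏ i : Fin T, if ω i then (2 / 3 : ℝ) else 1 - 2 / 3) = ∏ i, coin (ω i) := rfl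
  simp only [sum_Icc_one_eq_sum_fin T, hH, hW]
  let g (q : ℕ) (b : Bool) : ℝ := value (stepVal N) (N + N)
    (single (w (stepVal N) q) q).toBidVec (coinProfile (N + N) b)
  have halg : ∑ ω : Fin T → Bool, (∏ i, coin (ω i)) *
      ∑ i : Fin T, ∑ q ∈ Icc 1 (N + N), A ((i : ℕ) + 1) ω q * g q (ω i) ≤ T * N := by
    simp only [Finset.mul_sum (s := (univ : Finset (Fin T)))]
    rw [Finset.sum_comm]
    calc _ ≤ ∑ _i : Fin T, (N : ℝ) := Finset.sum_le_sum fun i _ =>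
          sum_prod_mul_mix_le _ coin_nonneg coin_add i (A ((i : ℕ) + 1)) (hA₀ _) (hA₁ _)
            (fun ω ω' h => hA _ ω ω' fun j hj => h j (by rintro rfl; simp at hj)) g
            fun q hq => coin_value_coinProfile_le (mem_Icc.1 hq).1 (mem_Icc.1 hq).2
      _ = T * N := by simp
  have hbest (ω : Fin T → Bool) :
      T * N + N / 2 * max 0 (∑ i, step (ω i)) ≤
        (Icc 1 (N + N)).sup' (Finset.nonempty_Icc.mpr (le_trans one_le_two hM))
          (fun q => ∑ i : Fin T, g q (ω i)) := by
    have hhalf := Finset.le_sup' (fun q => ∑ i : Fin T, g q (ω i))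
      (mem_Icc.2 ⟨hN, Nat.le_add_left N N⟩)
    have hfull := Finset.le_sup' (fun q => ∑ i : Fin T, g q (ω i))
      (mem_Icc.2 ⟨le_trans one_le_two hM, le_refl (N + N)⟩)
    simp only [g, value_coinProfile_half hN, value_coinProfile_full hN, Finset.sum_add_distrib,
      ← Finset.mul_sum, Finset.sum_const, Finset.card_univ, Fintype.card_fin, nsmul_eq_mul]
      at hhalf hfull
    rcases max_choice 0 (∑ i, step (ω i)) with h | h <;> rw [h]
    · rwa [mul_zero, add_zero]
    · exact hfull
  have hmax : T * N + N / 2 * (3 / 8 * √T) ≤ ∑ ω : Fin T → Bool, (∏ i, coin (ω i)) *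
      (Icc 1 (N + N)).sup' (Finset.nonempty_Icc.mpr (le_trans one_le_two hM))
        (fun q => ∑ i : Fin T, g q (ω i)) := by
    calc _ ≤ T * N + N / 2 * ∑ ω : Fin T → Bool, (∏ j, coin (ω j)) *
            max 0 (∑ j, step (ω j)) := by
          gcongr
          exact sqrt_le_sum_prod_coin_mul_max hT
      _ = ∑ ω : Fin T → Bool, (∏ i, coin (ω i)) *
            (T * N + N / 2 * max 0 (∑ i, step (ω i))) := by
          simp only [mul_add, Finset.sum_add_distrib, ← Finset.sum_mul, sum_prod_coin coin coin_add,
            Finset.mul_sum]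
          rw [one_mul]
          congr 1
          exact Finset.sum_congr rfl fun ω _ => by ring
      _ ≤ _ := Finset.sum_le_sum fun ω _ => mul_le_mul_of_nonneg_left (hbest ω)
          (Finset.prod_nonneg fun j _ => coin_nonneg _)
  simp only [mul_sub, Finset.sum_sub_distrib]
  push_cast
  linarith [halg, hmax]

end Auction
end

section
/- Impossibility under cumulative RoI constraints: let c ∈ (0,1], ε ∈ (0, c/2), and T a positive integer with εT ∈ ℕ. Take M = 1, K = 2, valuation vector v = (1) (so a 1-uniform strategy is a single bid b > 0 for one unit, and it is safe if and only if b ≤ 1). Define the bid history H₋ = (β₋^1,…,β₋^T) by: for t ≤ (1−ε)T, the top-2 competing bids of β₋^t are (3T, 1 + ε/2); for t > (1−ε)T, the top-2 competing bids of β₋^t are (ε, ε). Then: (i) the fixed strategy b* = (1+ε, 1) wins one unit in every round, obtains total value ∑_{t=1}^{T} V(b*;β₋^t) = T and total payment ∑_{t=1}^{T} P(b*;β₋^t) = T, hence satisfies the cumulative RoI constraint ∑_t V ≥ ∑_t P; and (ii) every sequence of strategies (b^t)_{t∈[T]} with the property that b^t is safe whenever ∑_{τ=1}^{t−1} V(b^τ;β₋^τ)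 = 0 obtains total value ∑_{t=1}^{T} V(b^t;β₋^t) ≤ εT. Consequently c·∑_{t=1}^{T} V(b*;β₋^t) − ∑_{t=1}^{T} V(b^t;β₋^t) ≥ cT − εT ≥ cT/2, so the c-approximate regret against the cumulative-RoI benchmark is at least cT/2 (linear in T) for every c ∈ (0,1]. -/
open Finset

namespace Auction

theorem alloc_of_demand_le_one {K : ℕ} (hK : 1 ≤ K) (b : BidVec) (hn : b.n ≤ 1) (β : Profile K) :
    alloc K b β = if b.n = 1 ∧ β.c 1 ≤ b.bid 1 then 1 else 0 := by
  classical
  unfold alloc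
  rcases (by omega : b.n = 0 ∨ b.n = 1) with h | h
  · simp [h]
  · rw [h, min_eq_left hK, Finset.Icc_self, Finset.filter_singleton, Finset.Icc_self]
    by_cases hb : β.c 1 ≤ b.bid 1 <;> simp [hb]

theorem value_of_demand_le_one {K : ℕ} (hK : 1 ≤ K) {v : ℕ → ℝ} (hv : v 1 = 1)
    (b : BidVec) (hn : b.n ≤ 1) (β : Profile K) :
    value v K b β = if b.n = 1 ∧ β.c 1 ≤ b.bid 1 then 1 else 0 := by
  unfold value
  rw [alloc_of_demand_le_one hK b hn]
  split_ifs <;> simp [hv]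

/-- A safe bid for a single unit of value `1` is at most `1`: otherwise it overpays when every
competing bid equals it. -/
theorem Safe.bid_le_one {v : ℕ → ℝ} (hv : v 1 = 1) {b : BidVec} (hb : b.Valid) (hn : b.n = 1)
    (hs : Safe v 2 b) : b.bid 1 ≤ 1 := by
  have hpos := hb.2 1 le_rfl hn.ge
  have h := hs ⟨fun _ => b.bid 1, fun _ _ _ _ _ => le_rfl, fun _ _ _ => hpos.le⟩
  rw [Feasible, payment, price, value_of_demand_le_one one_le_two hv b hn.le,
    alloc_of_demand_le_one one_le_two b hn.le] at h
  simpa [hn] using h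

@[simp]
theorem single_toBidVec_n (b : ℝ) (q : ℕ) : (single b q).toBidVec.n = q := by
  simp [single, Uniform.toBidVec, Uniform.Q]

@[simp]
theorem single_toBidVec_bid (b : ℝ) (q j : ℕ) : (single b q).toBidVec.bid j = b := rfl

theorem sum_Icc_ite_le_sub {T N : ℕ} (hNT : N ≤ T) (x y : ℝ) :
    (∑ t ∈ Finset.Icc 1 T, if t ≤ T - N then x else y) = ((T : ℝ) - N) * x + N * y := by
  have h₁ : (Finset.Icc 1 T).filter (fun t => t ≤ T - N) = Finset.Icc 1 (T - N) := by
    ext t; simp only [Finset.mem_filter, Finset.mem_Icc]; omega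
  have h₂ : (Finset.Icc 1 T).filter (fun t => ¬ t ≤ T - N) = Finset.Ioc (T - N) T := by
    ext t; simp only [Finset.mem_filter, Finset.mem_Icc, Finset.mem_Ioc]; omega
  rw [Finset.sum_ite, h₁, h₂]
  simp [Nat.sub_sub_self hNT, Nat.cast_sub hNT]

/-- Theorem `thm:cumulative-impossible`: with `M = 1`, `K = 2`,
`v = (1)` and the bid history whose top-2 competing bids are `(3T, 1 + ε/2)` for the
first `(1-ε)T` rounds and `(ε, ε)` for the last `εT` rounds:
(i) the fixed strategy `(1+ε, 1)` wins one unit every round, with total value `T` and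
total payment `T` (hence it satisfies the cumulative RoI constraint); and
(ii) every sequence of strategies that plays safely while its accumulated value is `0`
obtains total value at most `εT`, so its `c`-approximate regret is at least `c·T/2`. -/
theorem cumulative_roi_impossibility
    (c : ℝ) (hc0 : 0 < c) (hc1 : c ≤ 1)
    (ε : ℝ) (hε0 : 0 < ε) (hεc : ε < c / 2)
    (T N : ℕ) (hT : 1 ≤ T) (hN : (N : ℝ) = ε * T)
    (vOne : ℕ → ℝ) (hvOne : ∀ j : ℕ, vOne j = if j = 1 then 1 else 0)
    (βhigh βlow : Profile 2)
    (hβh1 : βhigh.c 1 = 1 + ε / 2) (hβh2 : βhigh.c 2 = 3 * T)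
    (hβl1 : βlow.c 1 = ε) (hβl2 : βlow.c 2 = ε)
    (H : ℕ → Profile 2)
    (hH : ∀ t : ℕ, 1 ≤ t → t ≤ T → H t = if t ≤ T - N then βhigh else βlow) :
    ((∀ t ∈ Finset.Icc 1 T, alloc 2 (single (1 + ε) 1).toBidVec (H t) = 1) ∧
      (∑ t ∈ Finset.Icc 1 T, value vOne 2 (single (1 + ε) 1).toBidVec (H t)) = T ∧
      (∑ t ∈ Finset.Icc 1 T, payment 2 (single (1 + ε) 1).toBidVec (H t)) = T) ∧
    ∀ b : ℕ → BidVec,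
      (∀ t : ℕ, (b t).Valid ∧ (b t).n ≤ 1) →
      (∀ t ∈ Finset.Icc 1 T,
        (∑ τ ∈ Finset.Icc 1 (t - 1), value vOne 2 (b τ) (H τ)) = 0 → Safe vOne 2 (b t)) →
      (∑ t ∈ Finset.Icc 1 T, value vOne 2 (b t) (H t)) ≤ ε * T ∧
      c * T / 2 ≤
        c * (∑ t ∈ Finset.Icc 1 T, value vOne 2 (single (1 + ε) 1).toBidVec (H t)) -
          ∑ t ∈ Finset.Icc 1 T, value vOne 2 (b t) (H t) := by
  have hv : vOne 1 = 1 := by simp [hvOne]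
  have hTr : (1 : ℝ) ≤ T := by exact_mod_cast hT
  have hNT : N ≤ T := by
    have : (N : ℝ) ≤ T := by rw [hN]; nlinarith
    exact_mod_cast this
  have hn : (single (1 + ε) 1).toBidVec.n ≤ 1 := by simp
  have hwin : ∀ t ∈ Finset.Icc 1 T, alloc 2 (single (1 + ε) 1).toBidVec (H t) = 1 := by
    intro t ht
    rw [Finset.mem_Icc] at ht
    have hle : (H t).c 1 ≤ 1 + ε := by
      rw [hH t ht.1 ht.2]
      split_ifs <;> linarith
    simp [alloc_of_demand_le_one one_le_two _ hn, hle]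
  have hval : (∑ t ∈ Finset.Icc 1 T, value vOne 2 (single (1 + ε) 1).toBidVec (H t)) = T := by
    rw [Finset.sum_congr rfl (g := fun _ => (1 : ℝ))]
    · simp
    · intro t ht
      simp [value, hwin t ht, hv]
  have hpay :
      (∑ t ∈ Finset.Icc 1 T, payment 2 (single (1 + ε) 1).toBidVec (H t)) = T := by
    rw [Finset.sum_congr rfl (g := fun t => if t ≤ T - N then 1 + ε else ε),
      sum_Icc_ite_le_sub hNT, hN]
    · ring
    · intro t ht
      have ht' := Finset.mem_Icc.1 ht
      have h₁ : 1 + ε ≤ 3 * T := by linarith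
      rw [payment, price, hwin t ht, hH t ht'.1 ht'.2]
      split_ifs <;> simp_all
  refine ⟨⟨hwin, hval, hpay⟩, fun b hb hsafe => ?_⟩
  have hzero : ∀ t, 1 ≤ t → t ≤ T - N → value vOne 2 (b t) (H t) = 0 := by
    intro t
    induction t using Nat.strong_induction_on with
    | _ t ih =>
      intro h1 ht
      have hs : Safe vOne 2 (b t) := by
        refine hsafe t (Finset.mem_Icc.2 ⟨h1, by omega⟩) (Finset.sum_eq_zero fun τ hτ => ?_)
        rw [Finset.mem_Icc] at hτ
        exact ih τ (by omega) hτ.1 (by omega)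
      rw [value_of_demand_le_one one_le_two hv _ (hb t).2, hH t h1 (by omega), if_pos ht, hβh1]
      refine if_neg fun h => ?_
      linarith [hs.bid_le_one hv (hb t).1 h.1, h.2]
  have hle : (∑ t ∈ Finset.Icc 1 T, value vOne 2 (b t) (H t)) ≤ ε * T := by
    calc _ ≤ ∑ t ∈ Finset.Icc 1 T, if t ≤ T - N then (0 : ℝ) else 1 := by
          refine Finset.sum_le_sum fun t ht => ?_
          split_ifs with h
          · exact (hzero t (Finset.mem_Icc.1 ht).1 h).le
          · rw [value_of_demand_le_one one_le_two hv _ (hb t).2]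
            split_ifs <;> norm_num
      _ = ε * T := by rw [sum_Icc_ite_le_sub hNT, ← hN]; ring
  refine ⟨hle, ?_⟩
  rw [hval]
  nlinarith

end Auction
end
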